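/- Let G₁ and G₂ be discrete convergence groups acting on a compact metrizable space M, suppose J = G₁ ∩ G₂ is geometrically finite and a proper subgroup of both G₁ and G₂, suppose G₁ and G₂ are in AFP ping-pong position with respect to J, and let G = ⟨G₁, G₂⟩ act on M as a convergence group. If G₁ and G₂ are geometrically finite, then every point of Λ(G) ∖ ⋃_{g ∈ G} g(Λ(G₁) ∪ Λ(G₂)) is a conical limit point for G. -/

import Mathlib

open Filter Topology Set

namespace ConvergenceGroups

variable {M : Type*} [TopologicalSpace M]

/-- The group of self-homeomorphisms of `M`, with `(g * h) x = g (h x)`. -/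
instance : Group (M ≃ₜ M) where
  mul g h := h.trans g
  one := Homeomorph.refl M
  inv := Homeomorph.symm
  mul_assoc _ _ _ := rfl
  one_mul _ := Homeomorph.ext fun _ => rfl
  mul_one _ := Homeomorph.ext fun _ => rfl
  inv_mul_cancel g := Homeomorph.ext fun x => g.symm_apply_apply x

/-- The inclusion of the self-homeomorphisms of `M` into the continuous self-maps of `M`;
the latter carries the compact-open topology. -/
def toCM (g : M ≃ₜ M) : C(M, M) := ⟨⇑g, g.continuous⟩

/-- `(g k)` is a convergence sequence with attracting point `zp` and repelling point `zm`:
the maps `g k` converge to the constant map `zp` uniformly on compact subsets of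
`M ∖ {zm}`. -/
def IsConvSeq (g : ℕ → M ≃ₜ M) (zp zm : M) : Prop :=
  ∀ K : Set M, IsCompact K → zm ∉ K → ∀ U ∈ 𝓝 zp,
    ∀ᶠ k in atTop, ∀ x ∈ K, g k x ∈ U

/-- `(g k)` converges in the compact-open topology to a homeomorphism. -/
def TendstoHomeo (g : ℕ → M ≃ₜ M) : Prop :=
  ∃ h : M ≃ₜ M, Tendsto (fun k => toCM (g k)) atTop (𝓝 (toCM h))

/-- `G` acts on `M` as a convergence group: every sequence of pairwise distinct elements of
`G` has a subsequence which either converges in the compact-open topology to a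
homeomorphism, or is a convergence sequence. -/
def IsConvGroup (G : Subgroup (M ≃ₜ M)) : Prop :=
  ∀ g : ℕ → M ≃ₜ M, (∀ k, g k ∈ G) → Function.Injective g →
    ∃ φ : ℕ → ℕ, StrictMono φ ∧
      (TendstoHomeo (g ∘ φ) ∨ ∃ zp zm : M, IsConvSeq (g ∘ φ) zp zm)

/-- `G` acts on `M` as a discrete convergence group: every sequence of pairwise distinct
elements of `G` has a subsequence which is a convergence sequence. -/
def IsDiscreteConvGroup (G : Subgroup (M ≃ₜ M)) : Prop :=
  ∀ g : ℕ → M ≃ₜ M, (∀ k, g k ∈ G) → Function.Injective g →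
    ∃ φ : ℕ → ℕ, StrictMono φ ∧ ∃ zp zm : M, IsConvSeq (g ∘ φ) zp zm

/-- The limit set `Λ(G)`: the set of all attracting points of convergence sequences in `G`. -/
def limitSet (G : Subgroup (M ≃ₜ M)) : Set M :=
  {zp | ∃ g : ℕ → M ≃ₜ M, (∀ k, g k ∈ G) ∧ Function.Injective g ∧
    ∃ zm : M, IsConvSeq g zp zm}

/-- `x` is a conical limit point for `G`: there is a sequence of pairwise distinct elements
`g k` of `G` such that for every `z ≠ x` the pairs `(g k x, g k z)` remain in a compact
subset of `(M × M) ∖ Δ`. -/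
def IsConicalLimitPt (G : Subgroup (M ≃ₜ M)) (x : M) : Prop :=
  ∃ g : ℕ → M ≃ₜ M, (∀ k, g k ∈ G) ∧ Function.Injective g ∧
    ∀ z : M, z ≠ x → ∃ K : Set (M × M), IsCompact K ∧ (∀ p ∈ K, p.1 ≠ p.2) ∧
      ∀ k, (g k x, g k z) ∈ K

/-- `g` is elliptic: the closure of the cyclic group generated by `g` is compact in
`Homeo(M)` (viewed inside `C(M, M)` with the compact-open topology). -/
def IsEllipticElem (g : M ≃ₜ M) : Prop :=
  IsCompact (closure (Set.range fun n : ℤ => toCM (g ^ n))) ∧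
    closure (Set.range fun n : ℤ => toCM (g ^ n)) ⊆ Set.range (toCM (M := M))

/-- `g` is parabolic: not elliptic, and fixes exactly one point of `M`. -/
def IsParabolicElem (g : M ≃ₜ M) : Prop :=
  ¬IsEllipticElem g ∧ ∃! x : M, g x = x

/-- `g` is loxodromic: not elliptic, and fixes exactly two points of `M`. -/
def IsLoxodromicElem (g : M ≃ₜ M) : Prop :=
  ¬IsEllipticElem g ∧ ∃ a b : M, a ≠ b ∧ {x : M | g x = x} = {a, b}

/-- `p` is a parabolic point for `G`: it is the fixed point of a parabolic element of `G`. -/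
def IsParabolicPt (G : Subgroup (M ≃ₜ M)) (p : M) : Prop :=
  ∃ g ∈ G, IsParabolicElem g ∧ g p = p

/-- `p` is a bounded parabolic point for `G`: it is a parabolic point and the quotient of
`Λ(G) ∖ {p}` by the stabilizer of `p` in `G` is compact. -/
def IsBoundedParabolicPt (G : Subgroup (M ≃ₜ M)) (p : M) : Prop :=
  IsParabolicPt G p ∧
    ∃ K : Set M, IsCompact K ∧ K ⊆ limitSet G \ {p} ∧
      ∀ x ∈ limitSet G \ {p}, ∃ h ∈ G, h p = p ∧ h x ∈ K

/-- `G` is geometrically finite: every point of `Λ(G)` is a conical limit point or a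
bounded parabolic point. -/
def IsGeomFinite (G : Subgroup (M ≃ₜ M)) : Prop :=
  ∀ x ∈ limitSet G, IsConicalLimitPt G x ∨ IsBoundedParabolicPt G x

/-- `J` is a fully quasi-convex subgroup of `G`: `J ≤ G`, `J` acts geometrically finitely,
and `g Λ(J) ∩ Λ(J) = ∅` for all but finitely many left cosets `gJ`. -/
def IsFullyQuasiconvex (G J : Subgroup (M ≃ₜ M)) : Prop :=
  J ≤ G ∧ IsGeomFinite J ∧
    ∃ F : Set (M ≃ₜ M), F.Finite ∧ ∀ g ∈ G,
      (⇑g '' limitSet J ∩ limitSet J).Nonempty → ∃ f ∈ F, ∃ j ∈ J, g = f * j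

/-- `G₁` and `G₂` are in AFP ping-pong position with respect to `J = G₁ ∩ G₂`, witnessed by
the closed sets `B₁`, `B₂`. -/
structure AFPPingPong (G₁ G₂ J : Subgroup (M ≃ₜ M)) (B₁ B₂ : Set M) : Prop where
  isClosed₁ : IsClosed B₁
  isClosed₂ : IsClosed B₂
  int_nonempty₁ : (interior B₁).Nonempty
  int_nonempty₂ : (interior B₂).Nonempty
  int_disjoint : interior B₁ ∩ interior B₂ = ∅
  inv₁ : ∀ j ∈ J, ⇑j '' B₁ = B₁
  inv₂ : ∀ j ∈ J, ⇑j '' B₂ = B₂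
  pp₁ : ∀ g ∈ G₁, g ∉ J → ⇑g '' B₁ ⊆ interior B₂
  pp₂ : ∀ g ∈ G₂, g ∉ J → ⇑g '' B₂ ⊆ interior B₁
  lim₁ : limitSet G₁ \ limitSet J ⊆ interior B₂
  lim₂ : limitSet G₂ \ limitSet J ⊆ interior B₁

/-- `G₀` is in HNN ping-pong position with respect to `f`, `J₁`, `J₋₁`, witnessed by the
closed sets `B₁`, `Bm` (where `Bm` plays the role of `B₋₁`). -/
structure HNNPingPong (G₀ J₁ Jm : Subgroup (M ≃ₜ M)) (f : M ≃ₜ M) (B₁ Bm : Set M) :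
    Prop where
  isClosed₁ : IsClosed B₁
  isClosedm : IsClosed Bm
  int_nonempty₁ : (interior B₁).Nonempty
  int_nonemptym : (interior Bm).Nonempty
  int_disjoint : interior B₁ ∩ interior Bm = ∅
  inv₁ : ∀ j ∈ J₁, ⇑j '' B₁ = B₁
  invm : ∀ j ∈ Jm, ⇑j '' Bm = Bm
  prec₁ : ∀ g ∈ G₀, g ∉ J₁ → ⇑g '' B₁ ∩ B₁ = ∅
  precm : ∀ g ∈ G₀, g ∉ Jm → ⇑g '' Bm ∩ Bm = ∅
  cross : ∀ g ∈ G₀, ⇑g '' B₁ ∩ Bm = ∅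
  mapf : ⇑f '' ((B₁ ∪ Bm)ᶜ ∪ B₁) = interior B₁
  lim₁ : limitSet G₀ ∩ B₁ = limitSet J₁
  limm : limitSet G₀ ∩ Bm = limitSet Jm
  proper : (⋃ g ∈ G₀, ⇑g '' (B₁ ∪ Bm))ᶜ.Nonempty

/-- A letter of type `i` (`i = 0` for `G₁`, `i = 1` for `G₂`) for amalgamated free product
normal forms: an element of `G_{i+1} ∖ J`. -/
def AFPLetter (G₁ G₂ J : Subgroup (M ≃ₜ M)) (i : Fin 2) (g : M ≃ₜ M) : Prop :=
  g ∈ (if i = 0 then G₁ else G₂) ∧ g ∉ J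

/-- `h` is an `(i,j)`-form: a product of a nonempty alternating list of letters, whose first
letter lies in `G_i ∖ J` and whose last letter lies in `G_j ∖ J` (indices shifted so that
`0` stands for `G₁` and `1` for `G₂`). -/
def IsIJForm (G₁ G₂ J : Subgroup (M ≃ₜ M)) (i j : Fin 2) (h : M ≃ₜ M) : Prop :=
  ∃ l : List (M ≃ₜ M), l ≠ [] ∧ l.prod = h ∧
    (∀ g ∈ l, AFPLetter G₁ G₂ J 0 g ∨ AFPLetter G₁ G₂ J 1 g) ∧
    l.Chain' (fun a b => ∀ c : Fin 2, AFPLetter G₁ G₂ J c a → AFPLetter G₁ G₂ J (1 - c) b) ∧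
    (∀ hne : l ≠ [], AFPLetter G₁ G₂ J i (l.head hne)) ∧
    (∀ hne : l ≠ [], AFPLetter G₁ G₂ J j (l.getLast hne))

set_option linter.unusedSectionVars false

section
variable {X : Type*} [MetricSpace X]

theorem mul_app (g h : X ≃ₜ X) (x : X) : (g * h) x = g (h x) := rfl

theorem inv_app_self (g : X ≃ₜ X) (x : X) : g⁻¹ (g x) = x := g.symm_apply_apply x

theorem app_inv_self (g : X ≃ₜ X) (x : X) : g (g⁻¹ x) = x := g.apply_symm_apply x

theorem mul_image (g h : X ≃ₜ X) (s : Set X) : ⇑(g * h) '' s = g '' (h '' s) :=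
  image_comp g h s

theorem mem_image_iff_inv {g : X ≃ₜ X} {s : Set X} {x : X} : x ∈ g '' s ↔ g⁻¹ x ∈ s := by
  constructor
  · rintro ⟨y, hy, rfl⟩
    rwa [inv_app_self]
  · intro h
    exact ⟨g⁻¹ x, h, app_inv_self g x⟩

/-- The sets `p k` are eventually contained in every neighbourhood of `s`. -/
def Shrinks (p : ℕ → Set X) (s : X) : Prop := ∀ U ∈ 𝓝 s, ∀ᶠ k in atTop, p k ⊆ U

theorem Shrinks.comp {p : ℕ → Set X} {s : X} (h : Shrinks p s) {φ : ℕ → ℕ} (hφ : StrictMono φ) :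
    Shrinks (p ∘ φ) s :=
  fun U hU => hφ.tendsto_atTop.eventually (h U hU)

theorem Shrinks.tendsto {p : ℕ → Set X} {s : X} (h : Shrinks p s) {y : ℕ → X}
    (hy : ∀ k, y k ∈ p k) : Tendsto y atTop (𝓝 s) := fun U hU => by
  rw [mem_map]
  filter_upwards [h U hU] with k hk
  exact hk (hy k)

theorem shrinks_singleton {y : ℕ → X} {s : X} (h : Tendsto y atTop (𝓝 s)) :
    Shrinks (fun k => {y k}) s := fun U hU => by
  filter_upwards [h hU] with k hk
  exact singleton_subset_iff.2 hk

variable {g : ℕ → X ≃ₜ X} {a b : X}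

theorem IsConvSeq.comp (h : IsConvSeq g a b) {φ : ℕ → ℕ} (hφ : StrictMono φ) :
    IsConvSeq (g ∘ φ) a b :=
  fun K hK hb U hU => hφ.tendsto_atTop.eventually (h K hK hb U hU)

theorem IsConvSeq.mul_left (h : IsConvSeq g a b) (c : X ≃ₜ X) :
    IsConvSeq (fun k => c * g k) (c a) b := fun K hK hb U hU =>
  h K hK hb (c ⁻¹' U) (c.continuous.continuousAt hU)

theorem IsConvSeq.tendsto (h : IsConvSeq g a b) {x : X} (hx : x ≠ b) :
    Tendsto (fun k => g k x) atTop (𝓝 a) := fun U hU => by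
  rw [mem_map]
  filter_upwards [h {x} isCompact_singleton (fun h => hx h.symm) U hU] with k hk
  exact hk x rfl

variable [CompactSpace X]

theorem IsConvSeq.inv (h : IsConvSeq g a b) : IsConvSeq (fun k => (g k)⁻¹) b a := by
  intro K hK ha U hU
  have h1 : b ∉ (interior U)ᶜ := fun h => h (mem_interior_iff_mem_nhds.2 hU)
  filter_upwards [h _ isOpen_interior.isClosed_compl.isCompact h1 Kᶜ
    (hK.isClosed.isOpen_compl.mem_nhds ha)] with k hk x hx
  by_contra hc
  have := hk _ (fun h => hc (interior_subset h))
  rw [app_inv_self] at this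
  exact this hx

theorem IsConvSeq.shrinks_image (h : IsConvSeq g a b) {p : ℕ → Set X} {y : X}
    (hp : Shrinks p y) (hy : y ≠ b) : Shrinks (fun k => g k '' p k) a := by
  intro U hU
  have hd := dist_pos.2 hy
  have h1 : b ∉ Metric.closedBall y (dist y b / 2) := by
    rw [Metric.mem_closedBall, dist_comm]; linarith
  filter_upwards [h _ (Metric.isClosed_closedBall).isCompact h1 U hU,
    hp _ (Metric.closedBall_mem_nhds y (half_pos hd))] with k hk hk'
  rintro _ ⟨x, hx, rfl⟩
  exact hk x (hk' hx)

theorem IsConvSeq.shrinks_closed (h : IsConvSeq g a b) {B : Set X} (hB : IsClosed B)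
    (hb : b ∉ B) : Shrinks (fun k => g k '' B) a := by
  intro U hU
  filter_upwards [h _ hB.isCompact hb U hU] with k hk
  rintro _ ⟨x, hx, rfl⟩
  exact hk x hx

theorem IsConvSeq.tendsto_of_tendsto (h : IsConvSeq g a b) {y : ℕ → X} {y₀ : X}
    (hy : Tendsto y atTop (𝓝 y₀)) (hne : y₀ ≠ b) : Tendsto (fun k => g k (y k)) atTop (𝓝 a) :=
  (h.shrinks_image (shrinks_singleton hy) hne).tendsto fun _ => mem_image_of_mem _ rfl

theorem mem_limitSet_of_attracting {G : Subgroup (X ≃ₜ X)} (hg : ∀ k, g k ∈ G)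
    (hinj : Function.Injective g) (h : IsConvSeq g a b) : a ∈ limitSet G :=
  ⟨g, hg, hinj, b, h⟩

theorem mem_limitSet_of_repelling {G : Subgroup (X ≃ₜ X)} (hg : ∀ k, g k ∈ G)
    (hinj : Function.Injective g) (h : IsConvSeq g a b) : b ∈ limitSet G :=
  ⟨_, fun k => G.inv_mem (hg k), fun _ _ h => hinj (inv_injective h), a, h.inv⟩

theorem limitSet_mono {G H : Subgroup (X ≃ₜ X)} (h : G ≤ H) : limitSet G ⊆ limitSet H :=
  fun _ ⟨g, hg, hi, b, hc⟩ => ⟨g, fun k => h (hg k), hi, b, hc⟩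

theorem app_mem_limitSet {G : Subgroup (X ≃ₜ X)} {c : X ≃ₜ X} (hc : c ∈ G) {x : X}
    (hx : x ∈ limitSet G) : c x ∈ limitSet G := by
  obtain ⟨g, hg, hi, b, h⟩ := hx
  exact ⟨_, fun k => G.mul_mem hc (hg k), fun _ _ h => hi (mul_left_cancel h), b, h.mul_left c⟩

theorem infinite_of_mem_limitSet {G : Subgroup (X ≃ₜ X)} {x : X} (hx : x ∈ limitSet G) :
    Infinite X := by
  by_contra hfin
  rw [not_infinite_iff_finite] at hfin
  obtain ⟨g, -, hi, -⟩ := hx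
  have : Finite (X ≃ₜ X) :=
    Finite.of_injective (fun g : X ≃ₜ X => (g : X → X)) DFunLike.coe_injective
  exact not_injective_infinite_finite g hi

theorem exists_ne₂ [Infinite X] (a b : X) : ∃ x, x ≠ a ∧ x ≠ b := by
  obtain ⟨x, hx⟩ := (Set.toFinite ({a, b} : Set X)).infinite_compl.nonempty
  exact ⟨x, by simpa [not_or] using hx⟩

theorem exists_ne₃ [Infinite X] (a b c : X) : ∃ x, x ≠ a ∧ x ≠ b ∧ x ≠ c := by
  obtain ⟨x, hx⟩ := (Set.toFinite ({a, b, c} : Set X)).infinite_compl.nonempty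
  exact ⟨x, by simpa [not_or] using hx⟩

theorem exists_ne_of_mem_nhds_limitSet {G : Subgroup (X ≃ₜ X)} {p : X} (hp : p ∈ limitSet G)
    {U : Set X} (hU : U ∈ 𝓝 p) : ∃ y ∈ U, y ≠ p := by
  have := infinite_of_mem_limitSet hp
  obtain ⟨g, hg, hi, b, h⟩ := hp
  obtain ⟨x, hx, -⟩ := exists_ne₂ b b
  obtain ⟨y, hy, hxy⟩ := exists_ne₂ b x
  obtain ⟨k, hk, hk'⟩ :=
    (((h.tendsto hx).eventually_mem hU).and ((h.tendsto hy).eventually_mem hU)).exists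
  by_cases h1 : g k x = p
  · exact ⟨g k y, hk', fun h2 => hxy ((g k).injective (h2.trans h1.symm))⟩
  · exact ⟨_, hk, h1⟩

theorem exists_ne_of_isOpen {G : Subgroup (X ≃ₜ X)} {p : X} (hp : p ∈ limitSet G)
    {U : Set X} (hU : IsOpen U) (hne : U.Nonempty) : ∃ y ∈ U, y ≠ p := by
  by_cases h : p ∈ U
  · exact exists_ne_of_mem_nhds_limitSet hp (hU.mem_nhds h)
  · obtain ⟨y, hy⟩ := hne
    exact ⟨y, hy, fun h' => h (h' ▸ hy)⟩

end

theorem exists_subseq_eq_or_ne {α β : Type*} (c : α → β) (f : ℕ → α) :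
    ∃ φ : ℕ → ℕ, StrictMono φ ∧
      ((∀ m n, c (f (φ m)) = c (f (φ n))) ∨ ∀ m n, m < n → c (f (φ m)) ≠ c (f (φ n))) := by
  obtain ⟨φ, h | h⟩ := exists_increasing_or_nonincreasing_subseq (· = ·) (c ∘ f)
  · refine ⟨φ, φ.strictMono, Or.inl fun m n => ?_⟩
    rcases lt_trichotomy m n with hl | rfl | hl
    · exact h _ _ hl
    · rfl
    · exact (h _ _ hl).symm
  · exact ⟨φ, φ.strictMono, Or.inr h⟩

theorem injective_of_lt_ne {β : Type*} {f : ℕ → β} (h : ∀ m n, m < n → f m ≠ f n) :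
    Function.Injective f := by
  intro m n hmn
  rcases lt_trichotomy m n with hl | rfl | hl
  · exact absurd hmn (h _ _ hl)
  · rfl
  · exact absurd hmn.symm (h _ _ hl)

theorem exists_subseq_const_or_injective {α : Type*} (f : ℕ → α) :
    ∃ φ : ℕ → ℕ, StrictMono φ ∧ ((∃ c, ∀ k, f (φ k) = c) ∨ Function.Injective (f ∘ φ)) := by
  obtain ⟨φ, hφ, h | h⟩ := exists_subseq_eq_or_ne id f
  · exact ⟨φ, hφ, Or.inl ⟨f (φ 0), fun k => h k 0⟩⟩
  · exact ⟨φ, hφ, Or.inr (injective_of_lt_ne h)⟩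

section
variable {X : Type*} [MetricSpace X] [CompactSpace X]

theorem IsDiscreteConvGroup.mono {G H : Subgroup (X ≃ₜ X)} (hH : IsDiscreteConvGroup H)
    (h : G ≤ H) : IsDiscreteConvGroup G := fun g hg hi => hH g (fun k => h (hg k)) hi

theorem IsDiscreteConvGroup.dichotomy {G : Subgroup (X ≃ₜ X)} (hG : IsDiscreteConvGroup G)
    {g : ℕ → X ≃ₜ X} (hg : ∀ k, g k ∈ G) :
    ∃ φ : ℕ → ℕ, StrictMono φ ∧ ((∃ c, ∀ k, g (φ k) = c) ∨
      Function.Injective (g ∘ φ) ∧ ∃ a b, IsConvSeq (g ∘ φ) a b) := by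
  obtain ⟨φ, hφ, h | h⟩ := exists_subseq_const_or_injective g
  · exact ⟨φ, hφ, Or.inl h⟩
  · obtain ⟨ψ, hψ, a, b, hab⟩ := hG (g ∘ φ) (fun k => hg _) h
    exact ⟨φ ∘ ψ, hφ.comp hψ, Or.inr ⟨h.comp hψ.injective, a, b, hab⟩⟩

theorem IsConvGroup.dichotomy {G : Subgroup (X ≃ₜ X)} (hG : IsConvGroup G)
    {g : ℕ → X ≃ₜ X} (hg : ∀ k, g k ∈ G) :
    ∃ φ : ℕ → ℕ, StrictMono φ ∧ (TendstoHomeo (g ∘ φ) ∨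
      Function.Injective (g ∘ φ) ∧ ∃ a b, IsConvSeq (g ∘ φ) a b) := by
  obtain ⟨φ, hφ, ⟨c, hc⟩ | h⟩ := exists_subseq_const_or_injective g
  · refine ⟨φ, hφ, Or.inl ⟨c, ?_⟩⟩
    have : (fun k => toCM ((g ∘ φ) k)) = fun _ => toCM c := funext fun k => congrArg toCM (hc k)
    rw [this]
    exact tendsto_const_nhds
  · obtain ⟨ψ, hψ, h' | ⟨a, b, hab⟩⟩ := hG (g ∘ φ) (fun k => hg _) h
    · exact ⟨φ ∘ ψ, hφ.comp hψ, Or.inl h'⟩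
    · exact ⟨φ ∘ ψ, hφ.comp hψ, Or.inr ⟨h.comp hψ.injective, a, b, hab⟩⟩

theorem exists_subseq_tendsto (y : ℕ → X) :
    ∃ a, ∃ φ : ℕ → ℕ, StrictMono φ ∧ Tendsto (y ∘ φ) atTop (𝓝 a) :=
  CompactSpace.tendsto_subseq y

/-- `q` is a conical limit point of `J`, witnessed by a convergence sequence whose values at `q`
converge away from its attracting point. -/
def Conic (J : Subgroup (X ≃ₜ X)) (q : X) : Prop :=
  ∃ j : ℕ → X ≃ₜ X, (∀ k, j k ∈ J) ∧ ∃ b c, b ≠ c ∧ IsConvSeq j c q ∧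
    Tendsto (fun k => j k q) atTop (𝓝 b)

theorem IsConicalLimitPt.conic [Infinite X] {J : Subgroup (X ≃ₜ X)} (hJ : IsDiscreteConvGroup J)
    {q : X} (hq : IsConicalLimitPt J q) : Conic J q := by
  obtain ⟨g, hg, hi, h⟩ := hq
  obtain ⟨φ, hφ, c, t, hc⟩ := hJ g hg hi
  obtain ⟨b, ψ, hψ, hb⟩ := exists_subseq_tendsto fun k => g (φ k) q
  have hc' := hc.comp hψ
  have key : ∀ z, z ≠ q → z ≠ t → b ≠ c := by
    intro z hz hzt
    obtain ⟨K, hK, hK', hk⟩ := h z hz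
    have h1 : Tendsto (fun k => (g (φ (ψ k)) q, g (φ (ψ k)) z)) atTop (𝓝 (b, c)) :=
      hb.prodMk_nhds (hc'.tendsto hzt)
    exact hK' _ (hK.isClosed.mem_of_tendsto h1 (Eventually.of_forall fun k => hk _))
  obtain ⟨z, hz, hzt⟩ := exists_ne₂ q t
  have hbc := key z hz hzt
  have hqt : q = t := by
    by_contra hne
    exact hbc (tendsto_nhds_unique hb (hc'.tendsto hne))
  subst hqt
  exact ⟨fun k => g (φ (ψ k)), fun k => hg _, b, c, hbc, hc', hb⟩

end

section
variable {X : Type*} [MetricSpace X] [CompactSpace X]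

theorem finite_lost {J : Subgroup (X ≃ₜ X)} (hJ : IsDiscreteConvGroup J) {w : X}
    (hw : w ∉ limitSet J) {A A' : Set X} (hA : IsClosed A) (hA' : IsClosed A')
    (hd : Disjoint A A') {T : Set (X × X)} (hT : IsCompact T)
    (hT' : ∀ p ∈ T, p.1 ≠ p.2 ∨ p.1 ∉ limitSet J) :
    {l | l ∈ J ∧ l w ∈ A ∧ ∃ p ∈ T, l p.1 ∈ A' ∧ l p.2 ∈ A'}.Finite := by
  by_contra hinf
  let F := Set.Infinite.natEmbedding _ hinf
  have hF : ∀ k, (F k : X ≃ₜ X) ∈ J := fun k => (F k).2.1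
  obtain ⟨φ, hφ, a, b, hab⟩ := hJ (fun k => (F k : X ≃ₜ X)) hF
    (fun m n h => F.injective (Subtype.ext h))
  have hb : b ∈ limitSet J := mem_limitSet_of_repelling (g := (fun k => (F k : X ≃ₜ X)) ∘ φ)
    (fun k => hF _) (fun m n h => hφ.injective (F.injective (Subtype.ext h))) hab
  have hwb : w ≠ b := fun h => hw (h ▸ hb)
  have haA : a ∈ A := hA.mem_of_tendsto (hab.tendsto hwb)
    (Eventually.of_forall fun k => (F (φ k)).2.2.1)
  choose p hpT hp1 hp2 using fun k => (F (φ k)).2.2.2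
  obtain ⟨p₀, hp₀, ψ, hψ, hlim⟩ := hT.tendsto_subseq hpT
  have hc := hab.comp hψ
  have haA' : a ∈ A' := by
    by_cases h1 : p₀.1 = b
    · have h2 : p₀.2 ≠ b := by
        rcases hT' _ hp₀ with h | h
        · exact fun h' => h (h1.trans h'.symm)
        · exact absurd (h1 ▸ hb) h
      exact hA'.mem_of_tendsto (hc.tendsto_of_tendsto
        ((continuous_snd.tendsto p₀).comp hlim) h2) (Eventually.of_forall fun k => hp2 _)
    · exact hA'.mem_of_tendsto (hc.tendsto_of_tendsto
        ((continuous_fst.tendsto p₀).comp hlim) h1) (Eventually.of_forall fun k => hp1 _)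
  exact disjoint_left.1 hd haA haA'

/-- The pairs of points which are not within `1 / (s + 1)` of the diagonal of `Λ`. -/
def thick (Λ : Set X) (s : ℕ) : Set (X × X) :=
  {p | 1 / ((s : ℝ) + 1) ≤ dist p.1 p.2 + Metric.infDist p.1 Λ}

theorem isCompact_thick (Λ : Set X) (s : ℕ) : IsCompact (thick Λ s) := by
  apply IsClosed.isCompact
  exact isClosed_le continuous_const
    ((continuous_fst.dist continuous_snd).add
      ((Metric.continuous_infDist_pt Λ).comp continuous_fst))

theorem thick_mono (Λ : Set X) {s t : ℕ} (h : s ≤ t) : thick Λ s ⊆ thick Λ t := by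
  intro p hp
  refine le_trans ?_ (show 1 / ((s : ℝ) + 1) ≤ dist p.1 p.2 + Metric.infDist p.1 Λ from hp)
  exact one_div_le_one_div_of_le (by positivity) (by gcongr)

theorem ne_or_notMem_of_mem_thick {Λ : Set X} {s : ℕ} {p : X × X} (hp : p ∈ thick Λ s) :
    p.1 ≠ p.2 ∨ p.1 ∉ Λ := by
  by_contra! h
  have h1 : 1 / ((s : ℝ) + 1) ≤ dist p.1 p.2 + Metric.infDist p.1 Λ := hp
  rw [dist_eq_zero.2 h.1, Metric.infDist_zero_of_mem h.2] at h1
  have : 0 < 1 / ((s : ℝ) + 1) := by positivity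
  linarith

theorem exists_mem_thick {Λ : Set X} (hΛ : Λ.Nonempty) {y : X} (hy : y ∉ closure Λ) :
    ∃ s, (y, y) ∈ thick Λ s := by
  have h1 : 0 < Metric.infDist y Λ :=
    lt_of_le_of_ne Metric.infDist_nonneg fun h =>
      hy ((Metric.mem_closure_iff_infDist_zero hΛ).2 h.symm)
  obtain ⟨s, hs⟩ := exists_nat_one_div_lt h1
  exact ⟨s, by simpa [thick] using hs.le⟩

theorem mem_thick_of_dist {Λ : Set X} {ε : ℝ} (hε : 0 < ε) :
    ∃ s, ∀ y y' : X, ε ≤ dist y y' → (y, y') ∈ thick Λ s := by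
  obtain ⟨s, hs⟩ := exists_nat_one_div_lt hε
  refine ⟨s, fun y y' h => ?_⟩
  have : 0 ≤ Metric.infDist y Λ := Metric.infDist_nonneg
  show 1 / ((s : ℝ) + 1) ≤ dist y y' + Metric.infDist y Λ
  linarith

theorem exists_weights (n : ℕ → ℕ → ℕ) :
    ∃ θ : ℕ → ℝ, (∀ i, 0 < θ i) ∧ (∀ i, θ i ≤ 1) ∧ ∃ C : ℕ → ℝ, ∀ s (I : Finset ℕ),
      ∑ i ∈ I, (n i s : ℝ) * θ i ≤ C s := by
  let D : ℕ → ℝ := fun i => 1 + ∑ s ∈ Finset.range (i + 1), (n i s : ℝ)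
  have hD : ∀ i, 1 ≤ D i := fun i => by
    have : 0 ≤ ∑ s ∈ Finset.range (i + 1), (n i s : ℝ) := Finset.sum_nonneg fun _ _ => by positivity
    simp only [D]; linarith
  have hθ1 : ∀ i, (1 / 2 : ℝ) ^ i / D i ≤ (1 / 2 : ℝ) ^ i := fun i =>
    div_le_self (by positivity) (hD i)
  have hle1 : ∀ i, (1 / 2 : ℝ) ^ i / D i ≤ 1 := fun i =>
    (hθ1 i).trans (pow_le_one₀ (by norm_num) (by norm_num))
  refine ⟨fun i => (1 / 2 : ℝ) ^ i / D i, fun i => ?_, hle1,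
    fun s => ∑ i ∈ Finset.range s, (n i s : ℝ) + 2, fun s I => ?_⟩
  · have := hD i
    positivity
  · have key : ∀ i, (n i s : ℝ) * ((1 / 2 : ℝ) ^ i / D i) ≤
        (if i < s then (n i s : ℝ) else 0) + (1 / 2 : ℝ) ^ i := by
      intro i
      by_cases h : i < s
      · rw [if_pos h]
        have h1 : (n i s : ℝ) * ((1 / 2 : ℝ) ^ i / D i) ≤ n i s * 1 := by
          gcongr
          exact hle1 i
        have : (0 : ℝ) ≤ (1 / 2 : ℝ) ^ i := by positivity
        linarith
      · rw [if_neg h, zero_add, ← mul_div_assoc, mul_comm, mul_div_assoc]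
        refine mul_le_of_le_one_right (by positivity) ?_
        rw [div_le_one (lt_of_lt_of_le one_pos (hD i))]
        have : (n i s : ℝ) ≤ ∑ s ∈ Finset.range (i + 1), (n i s : ℝ) :=
          Finset.single_le_sum (f := fun s => (n i s : ℝ)) (fun _ _ => by positivity)
            (Finset.mem_range.2 (by omega))
        simp only [D]; linarith
    refine (Finset.sum_le_sum fun i _ => key i).trans ?_
    rw [Finset.sum_add_distrib]
    refine add_le_add ?_ ?_
    · rw [← Finset.sum_filter]
      refine Finset.sum_le_sum_of_subset_of_nonneg ?_ fun _ _ _ => by positivity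
      intro i hi
      exact Finset.mem_range.2 (Finset.mem_filter.1 hi).2
    · refine (summable_geometric_two.sum_le_tsum I fun i _ => by positivity).trans ?_
      rw [tsum_geometric_two]

/-- A finite set of labelled annuli separating `v` from `p`, pairwise nested. -/
def IsAnnChain (𝒜 : ℕ → Set (Set X × Set X)) (v : X) (p : Set X)
    (S : Finset (ℕ × (Set X × Set X))) : Prop :=
  (∀ e ∈ S, e.2 ∈ 𝒜 e.1 ∧ v ∈ e.2.1 ∧ p ⊆ e.2.2) ∧
    ∀ e ∈ S, ∀ e' ∈ S, e ≠ e' → e.2.2 ∪ e'.2.1 = univ ∨ e'.2.2 ∪ e.2.1 = univ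

open Classical in
theorem IsAnnChain.image {𝒜 : ℕ → Set (Set X × Set X)} {v : X} {p : Set X}
    {S : Finset (ℕ × (Set X × Set X))} (hS : IsAnnChain 𝒜 v p S) (h : X ≃ₜ X)
    (hinv : ∀ i, ∀ A ∈ 𝒜 i, (h '' A.1, h '' A.2) ∈ 𝒜 i) (θ : ℕ → ℝ) :
    ∃ S', IsAnnChain 𝒜 (h v) (h '' p) S' ∧ ∑ e ∈ S', θ e.1 = ∑ e ∈ S, θ e.1 ∧
      ∀ e' ∈ S', ∃ e ∈ S, e'.2.2 = h '' e.2.2 := by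
  let F : ℕ × (Set X × Set X) → ℕ × (Set X × Set X) := fun e => (e.1, (h '' e.2.1, h '' e.2.2))
  have hF : Function.Injective F := by
    rintro ⟨i, A, A'⟩ ⟨k, D, D'⟩ he
    simp only [F, Prod.mk.injEq] at he
    obtain ⟨h1, h2, h3⟩ := he
    rw [h.injective.image_injective h2, h.injective.image_injective h3, h1]
  refine ⟨S.image F, ⟨?_, ?_⟩, ?_, ?_⟩
  · intro e he
    obtain ⟨d, hd, rfl⟩ := Finset.mem_image.1 he
    obtain ⟨h1, h2, h3⟩ := hS.1 d hd
    exact ⟨hinv _ _ h1, mem_image_of_mem _ h2, image_mono h3⟩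
  · intro e he e' he' hne
    obtain ⟨d, hd, rfl⟩ := Finset.mem_image.1 he
    obtain ⟨d', hd', rfl⟩ := Finset.mem_image.1 he'
    have := hS.2 d hd d' hd' fun h => hne (h ▸ rfl)
    simp only [F, ← image_union]
    refine this.imp (fun h' => ?_) fun h' => ?_ <;> rw [h', image_univ, h.surjective.range_eq]
  · rw [Finset.sum_image fun _ _ _ _ h => hF h]
  · intro e he
    obtain ⟨d, hd, rfl⟩ := Finset.mem_image.1 he
    exact ⟨d, hd, rfl⟩

open Classical in
theorem exists_height (J : Subgroup (X ≃ₜ X)) (w : X)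
    (hΛ : (limitSet J).Nonempty) (𝒜 : ℕ → Set (Set X × Set X))
    (hinv : ∀ l ∈ J, ∀ i, ∀ A ∈ 𝒜 i, (l '' A.1, l '' A.2) ∈ 𝒜 i)
    (hdisj : ∀ i, ∀ A ∈ 𝒜 i, Disjoint A.1 A.2)
    (htame : ∀ i s, {A ∈ 𝒜 i | w ∈ A.1 ∧
      ∃ p ∈ thick (limitSet J) s, p.1 ∈ A.2 ∧ p.2 ∈ A.2}.Finite) :
    ∃ f : Set X → ℝ, ∃ θ C : ℕ → ℝ, (∀ i, 0 < θ i) ∧ (∀ p, 0 ≤ f p) ∧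
      ∀ (s : ℕ) (p : Set X) (h : X ≃ₜ X) (N : Set X) (Y : Finset (ℕ × (Set X × Set X))),
        h ∈ J → IsAnnChain 𝒜 w p Y → (∃ y ∈ p, y ∉ closure (limitSet J)) → w ∈ N →
        (∀ e ∈ Y, e.2.2ᶜ ⊆ N ∧ (N ∩ e.2.2).Nonempty) →
        (∀ y ∈ N, ∀ y' ∈ p, (h y, h y') ∈ thick (limitSet J) s) →
        ∑ e ∈ Y, θ e.1 + f (h '' p) - C s ≤ f p := by
  set Lost : ℕ → ℕ → Set (Set X × Set X) := fun i s => {A ∈ 𝒜 i | w ∈ A.1 ∧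
      ∃ p ∈ thick (limitSet J) s, p.1 ∈ A.2 ∧ p.2 ∈ A.2} with hLost
  obtain ⟨θ, hθ, hθ1, C, hC⟩ := exists_weights fun i s => (Lost i s).ncard
  have hlost : ∀ s (S : Finset (ℕ × (Set X × Set X))), (∀ e ∈ S, e.2 ∈ Lost e.1 s) →
      ∑ e ∈ S, θ e.1 ≤ C s := by
    intro s S hS
    refine le_trans (le_trans (Finset.sum_comp θ Prod.fst).le ?_) (hC s (S.image Prod.fst))
    refine Finset.sum_le_sum fun i _ => ?_
    rw [nsmul_eq_mul]
    refine mul_le_mul_of_nonneg_right ?_ (hθ i).le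
    rw [Nat.cast_le, ← Finset.card_image_of_injOn (f := Prod.snd)]
    · rw [← Set.ncard_coe_finset]
      refine Set.ncard_le_ncard ?_ (htame i s)
      intro A hA
      obtain ⟨e, he, rfl⟩ := Finset.mem_image.1 (Finset.mem_coe.1 hA)
      obtain ⟨he1, rfl⟩ := Finset.mem_filter.1 he
      exact hS e he1
    · intro e he e' he' h
      exact Prod.ext ((Finset.mem_filter.1 he).2.trans (Finset.mem_filter.1 he').2.symm) h
  let W : Set X → Set ℝ := fun p => {r | ∃ S, IsAnnChain 𝒜 w p S ∧ ∑ e ∈ S, θ e.1 = r}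
  have hW0 : ∀ p, (0 : ℝ) ∈ W p := fun p => ⟨∅, ⟨by simp, by simp⟩, by simp⟩
  have hWnn : ∀ p, ∀ r ∈ W p, 0 ≤ r := by
    rintro p _ ⟨S, -, rfl⟩
    exact Finset.sum_nonneg fun e _ => (hθ _).le
  have hWb : ∀ p, (∃ y ∈ p, y ∉ closure (limitSet J)) → BddAbove (W p) := by
    rintro p ⟨y, hy, hyc⟩
    obtain ⟨s, hs⟩ := exists_mem_thick hΛ hyc
    refine ⟨C s, ?_⟩
    rintro _ ⟨S, hS, rfl⟩
    refine hlost s S fun e he => ?_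
    obtain ⟨h1, h2, h3⟩ := hS.1 e he
    exact ⟨h1, h2, _, hs, h3 hy, h3 hy⟩
  refine ⟨fun p => sSup (W p), θ, fun s => C s + 2, hθ, fun p => Real.sSup_nonneg (hWnn p), ?_⟩
  rintro s p h N₀ Y₀ hh hY₀ ⟨y₁, hy₁, hy₁c⟩ hwN₀ hYN₀ hT₀
  set p' := h '' p
  set N := h '' N₀
  set y₀ := h y₁
  have hy₀ : y₀ ∈ p' := mem_image_of_mem _ hy₁
  have hwN : h w ∈ N := mem_image_of_mem _ hwN₀
  have hT : ∀ y ∈ N, ∀ y' ∈ p', (y, y') ∈ thick (limitSet J) s := by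
    rintro _ ⟨y, hy, rfl⟩ _ ⟨y', hy', rfl⟩
    exact hT₀ y hy y' hy'
  obtain ⟨Y, hY, hYs, hYY⟩ := hY₀.image h (hinv h hh) θ
  have hYN : ∀ e ∈ Y, e.2.2ᶜ ⊆ N ∧ (N ∩ e.2.2).Nonempty := by
    intro e he
    obtain ⟨d, hd, hde⟩ := hYY e he
    rw [hde, ← image_compl_eq h.bijective, ← image_inter h.injective]
    exact ⟨image_mono (hYN₀ d hd).1, (hYN₀ d hd).2.image _⟩
  obtain ⟨_, ⟨S, hS, rfl⟩, hlt⟩ := exists_lt_of_lt_csSup ⟨0, hW0 p'⟩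
    (show sSup (W p') - 1 < sSup (W p') by linarith)
  let S' := S.filter fun e => N ⊆ e.2.1
  let S₁ := S.filter fun e => ¬ N ⊆ e.2.1 ∧ (N ∩ e.2.2).Nonempty
  let S₂ := S.filter fun e => ¬ N ⊆ e.2.1 ∧ ¬ (N ∩ e.2.2).Nonempty
  have hsum : ∑ e ∈ S, θ e.1 = ∑ e ∈ S', θ e.1 + (∑ e ∈ S₁, θ e.1 + ∑ e ∈ S₂, θ e.1) := by
    rw [← Finset.sum_filter_add_sum_filter_not S (fun e => N ⊆ e.2.1),
      ← Finset.sum_filter_add_sum_filter_not (S.filter fun e => ¬ N ⊆ e.2.1)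
        (fun e => (N ∩ e.2.2).Nonempty), Finset.filter_filter, Finset.filter_filter]
  have hS1 : ∑ e ∈ S₁, θ e.1 ≤ C s := by
    refine hlost s S₁ fun e he => ?_
    obtain ⟨he1, -, y, hyN, hye⟩ := Finset.mem_filter.1 he
    obtain ⟨h1, h2, h3⟩ := hS.1 e he1
    exact ⟨h1, h2, (y, y₀), hT y hyN y₀ hy₀, hye, h3 hy₀⟩
  have hS2 : ∑ e ∈ S₂, θ e.1 ≤ 1 := by
    have hcard : S₂.card ≤ 1 := by
      rw [Finset.card_le_one]
      intro e he e' he'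
      obtain ⟨he1, he2, he3⟩ := Finset.mem_filter.1 he
      obtain ⟨he1', he2', he3'⟩ := Finset.mem_filter.1 he'
      by_contra hne
      have aux : ∀ {A D : Set X}, A ∪ D = univ → ¬ (N ∩ A).Nonempty → N ⊆ D := by
        intro A D h1 h2 y hy
        rcases (h1 ▸ mem_univ y : y ∈ A ∪ D) with h | h
        · exact absurd ⟨y, hy, h⟩ h2
        · exact h
      rcases hS.2 e he1 e' he1' hne with h | h
      · exact he2' (aux h he3)
      · exact he2 (aux h he3')
    calc ∑ e ∈ S₂, θ e.1 ≤ ∑ e ∈ S₂, (1 : ℝ) := Finset.sum_le_sum fun e _ => hθ1 _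
      _ = S₂.card := by simp
      _ ≤ 1 := by exact_mod_cast hcard
  have hdis : Disjoint Y S' := by
    rw [Finset.disjoint_left]
    intro e he he'
    obtain ⟨y, hy, hy'⟩ := (hYN e he).2
    exact disjoint_left.1 (hdisj _ _ (hY.1 e he).1) ((Finset.mem_filter.1 he').2 hy) hy'
  have hchain : IsAnnChain 𝒜 (h w) p' (Y ∪ S') := by
    have hmix : ∀ e ∈ Y, ∀ e' ∈ S', e.2.2 ∪ e'.2.1 = univ := by
      intro e he e' he'
      rw [eq_univ_iff_forall]
      intro y
      by_cases hy : y ∈ e.2.2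
      · exact Or.inl hy
      · exact Or.inr ((Finset.mem_filter.1 he').2 ((hYN e he).1 hy))
    constructor
    · intro e he
      rcases Finset.mem_union.1 he with he | he
      · exact hY.1 e he
      · obtain ⟨he1, he2⟩ := Finset.mem_filter.1 he
        obtain ⟨h1, -, h3⟩ := hS.1 e he1
        exact ⟨h1, he2 hwN, h3⟩
    · intro e he e' he' hne
      rcases Finset.mem_union.1 he with he | he <;> rcases Finset.mem_union.1 he' with he' | he'
      · exact hY.2 e he e' he' hne
      · exact Or.inl (hmix e he e' he')
      · exact Or.inr (hmix e' he' e he)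
      · exact hS.2 e (Finset.mem_filter.1 he).1 e' (Finset.mem_filter.1 he').1 hne
  obtain ⟨Z, hZ, hZs, -⟩ := hchain.image h⁻¹ (hinv _ (J.inv_mem hh)) θ
  rw [inv_app_self] at hZ
  have hpp : ⇑(h⁻¹) '' p' = p := h.symm_image_image p
  rw [hpp] at hZ
  have hfin : ∑ e ∈ Y ∪ S', θ e.1 ≤ sSup (W p) := le_csSup (hWb p ⟨y₁, hy₁, hy₁c⟩) ⟨Z, hZ, hZs⟩
  rw [Finset.sum_union hdis] at hfin
  show ∑ e ∈ Y₀, θ e.1 + sSup (W p') - (C s + 2) ≤ sSup (W p)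
  linarith

end

section
theorem exists_annuli (X : Type*) [MetricSpace X] [CompactSpace X] :
    ∃ D : ℕ → Set X × Set X,
      (∀ n, IsClosed (D n).1 ∧ IsClosed (D n).2 ∧ Disjoint (D n).1 (D n).2) ∧
      ∀ b c : X, b ≠ c → ∃ n, (D n).1 ∈ 𝓝 c ∧ (D n).2 ∈ 𝓝 b := by
  classical
  rcases isEmpty_or_nonempty X with hX | hX
  · exact ⟨fun _ => (∅, ∅), fun _ => ⟨isClosed_empty, isClosed_empty, disjoint_bot_left⟩,
      fun b => (hX.false b).elim⟩
  let x := TopologicalSpace.denseSeq X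
  let F : ℕ × ℕ × ℕ → Set X × Set X := fun t =>
    (Metric.closedBall (x t.1) (1 / ((t.2.2 : ℝ) + 1)),
      Metric.closedBall (x t.2.1) (1 / ((t.2.2 : ℝ) + 1)))
  obtain ⟨e, he⟩ := exists_surjective_nat (ℕ × ℕ × ℕ)
  refine ⟨fun n => if Disjoint (F (e n)).1 (F (e n)).2 then F (e n) else (∅, ∅),
    fun n => ?_, fun b c hbc => ?_⟩
  · dsimp only
    split_ifs with h
    · exact ⟨Metric.isClosed_closedBall, Metric.isClosed_closedBall, h⟩
    · exact ⟨isClosed_empty, isClosed_empty, disjoint_bot_left⟩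
  · have hd := dist_pos.2 hbc
    obtain ⟨k, hk⟩ := exists_nat_one_div_lt (show 0 < dist b c / 4 by linarith)
    have hε : 0 < 1 / ((k : ℝ) + 1) := by positivity
    obtain ⟨i, hi⟩ := (TopologicalSpace.denseRange_denseSeq X).exists_dist_lt c hε
    obtain ⟨l, hl⟩ := (TopologicalSpace.denseRange_denseSeq X).exists_dist_lt b hε
    obtain ⟨n, hn⟩ := he (i, l, k)
    have hdis : Disjoint (F (e n)).1 (F (e n)).2 := by
      rw [hn, disjoint_left]
      intro z hz hz'
      have h1 : dist z (x i) ≤ 1 / ((k : ℝ) + 1) := hz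
      have h2 : dist z (x l) ≤ 1 / ((k : ℝ) + 1) := hz'
      have h3 : dist c (x i) < 1 / ((k : ℝ) + 1) := hi
      have h4 : dist b (x l) < 1 / ((k : ℝ) + 1) := hl
      have h5 := dist_triangle4 b (x l) z c
      have h6 := dist_triangle z (x i) c
      rw [dist_comm (x l) z] at h5
      rw [dist_comm (x i) c] at h6
      linarith
    refine ⟨n, ?_, ?_⟩ <;> dsimp only <;> rw [if_pos hdis, hn]
    · exact mem_of_superset (Metric.isOpen_ball.mem_nhds hi) Metric.ball_subset_closedBall
    · exact mem_of_superset (Metric.isOpen_ball.mem_nhds hl) Metric.ball_subset_closedBall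

variable {X : Type*} [MetricSpace X] [CompactSpace X]

theorem finite_lost_orbit {J : Subgroup (X ≃ₜ X)} (hJ : IsDiscreteConvGroup J) {w : X}
    (hw : w ∉ limitSet J) {A A' : Set X} (hA : IsClosed A) (hA' : IsClosed A')
    (hd : Disjoint A A') (s : ℕ) :
    {Y : Set X × Set X | (∃ l ∈ J, Y = (l '' A, l '' A')) ∧ w ∈ Y.1 ∧
      ∃ p ∈ thick (limitSet J) s, p.1 ∈ Y.2 ∧ p.2 ∈ Y.2}.Finite := by
  refine ((finite_lost hJ hw hA hA' hd (isCompact_thick (limitSet J) s)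
    fun p hp => ne_or_notMem_of_mem_thick hp).image
      fun l : X ≃ₜ X => (⇑(l⁻¹) '' A, ⇑(l⁻¹) '' A')).subset ?_
  rintro _ ⟨⟨l, hl, rfl⟩, hwl, p, hp, h1, h2⟩
  refine ⟨l⁻¹, ⟨J.inv_mem hl, mem_image_iff_inv.1 hwl, p, hp, mem_image_iff_inv.1 h1,
    mem_image_iff_inv.1 h2⟩, ?_⟩
  simp only [inv_inv]

theorem exists_tower {J : Subgroup (X ≃ₜ X)} (hJ : IsDiscreteConvGroup J) {w q : X}
    (hw : w ∉ limitSet J) (hq : q ∈ limitSet J) :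
    ∃ ρ : ℕ → ℝ, (∀ r, 0 < ρ r) ∧ (∀ r, ρ (r + 1) ≤ ρ r / 2) ∧
      (∀ r, ∀ l ∈ J, l w ∈ Metric.closedBall q (ρ r / 2) → ∀ p ∈ thick (limitSet J) r,
        l p.1 ∉ Metric.ball q (ρ r) → l p.2 ∉ Metric.ball q (ρ r) → ρ (r + 1) < dist (l w) q) ∧
      ∀ r, ∃ t ∈ Metric.ball q (ρ r), ρ (r + 1) < dist t q := by
  have step : ∀ (r : ℕ) (x : {x : ℝ // 0 < x}), ∃ y : {x : ℝ // 0 < x}, y.1 ≤ x.1 / 2 ∧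
      (∀ l ∈ J, l w ∈ Metric.closedBall q (x.1 / 2) → ∀ p ∈ thick (limitSet J) r,
        l p.1 ∉ Metric.ball q x.1 → l p.2 ∉ Metric.ball q x.1 → y.1 < dist (l w) q) ∧
      ∃ t ∈ Metric.ball q x.1, y.1 < dist t q := by
    rintro r ⟨x, hx⟩
    obtain ⟨t, ht, htq⟩ := exists_ne_of_mem_nhds_limitSet hq (Metric.ball_mem_nhds q hx)
    have hfin := finite_lost hJ hw (Metric.isClosed_closedBall (x := q) (ε := x / 2))
      (Metric.isOpen_ball (x := q) (ε := x)).isClosed_compl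
      (disjoint_compl_right_iff_subset.2
        (Metric.closedBall_subset_ball (half_lt_self hx)))
      (isCompact_thick (limitSet J) r) fun p hp => ne_or_notMem_of_mem_thick hp
    have hev : ∀ᶠ y in 𝓝[>] (0 : ℝ), y ≤ x / 2 ∧ y < dist t q ∧ ∀ l ∈ {l | l ∈ J ∧
        l w ∈ Metric.closedBall q (x / 2) ∧ ∃ p ∈ thick (limitSet J) r,
          l p.1 ∈ (Metric.ball q x)ᶜ ∧ l p.2 ∈ (Metric.ball q x)ᶜ}, y < dist (l w) q := by
      have aux : ∀ z : ℝ, 0 < z → ∀ᶠ y in 𝓝[>] (0 : ℝ), y < z := fun z hz =>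
        mem_nhdsWithin_of_mem_nhds (Iio_mem_nhds hz)
      refine ((aux _ (half_pos hx)).mono fun y hy => hy.le).and
        ((aux _ (dist_pos.2 htq)).and ((eventually_all_finite hfin).2 fun l hl => aux _ ?_))
      refine dist_pos.2 fun h => hw ?_
      have := app_mem_limitSet (J.inv_mem hl.1) hq
      rwa [← h, inv_app_self] at this
    obtain ⟨y, ⟨h1, h2, h3⟩, hy0⟩ := (hev.and self_mem_nhdsWithin).exists
    exact ⟨⟨y, hy0⟩, h1, fun l hl hlw p hp hp1 hp2 => h3 l ⟨hl, hlw, p, hp, hp1, hp2⟩, t, ht, h2⟩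
  choose F hF1 hF2 hF3 using step
  let R : ℕ → {x : ℝ // 0 < x} := fun n => Nat.rec ⟨1, one_pos⟩ F n
  exact ⟨fun r => (R r).1, fun r => (R r).2, fun r => hF1 r (R r), fun r => hF2 r (R r),
    fun r => hF3 r (R r)⟩

/-- The translates of the round annuli about `q` with consecutive radii `ρ (r + 1)`, `ρ r`. -/
def towerFamily (J : Subgroup (X ≃ₜ X)) (q : X) (ρ : ℕ → ℝ) : Set (Set X × Set X) :=
  {Y | ∃ r, ∃ l ∈ J, Y = (l '' Metric.closedBall q (ρ (r + 1)), l '' (Metric.ball q (ρ r))ᶜ)}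

theorem finite_lost_tower {J : Subgroup (X ≃ₜ X)} (hJ : IsDiscreteConvGroup J) {w q : X}
    (hw : w ∉ limitSet J) {ρ : ℕ → ℝ} (hρ : ∀ r, 0 < ρ r) (hρ2 : ∀ r, ρ (r + 1) ≤ ρ r / 2)
    (hE : ∀ r, ∀ l ∈ J, l w ∈ Metric.closedBall q (ρ r / 2) → ∀ p ∈ thick (limitSet J) r,
        l p.1 ∉ Metric.ball q (ρ r) → l p.2 ∉ Metric.ball q (ρ r) → ρ (r + 1) < dist (l w) q)
    (s : ℕ) :
    {Y ∈ towerFamily J q ρ | w ∈ Y.1 ∧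
      ∃ p ∈ thick (limitSet J) s, p.1 ∈ Y.2 ∧ p.2 ∈ Y.2}.Finite := by
  refine ((finite_lt_nat s).biUnion fun r _ =>
    finite_lost_orbit hJ hw (Metric.isClosed_closedBall (x := q) (ε := ρ (r + 1)))
      (Metric.isOpen_ball (x := q) (ε := ρ r)).isClosed_compl
      (disjoint_compl_right_iff_subset.2
        (Metric.closedBall_subset_ball (by linarith [hρ r, hρ2 r]))) s).subset ?_
  rintro _ ⟨⟨r, l, hl, rfl⟩, hwl, p, hp, h1, h2⟩
  by_cases hrs : r < s
  · exact mem_biUnion (show r ∈ {r | r < s} from hrs) ⟨⟨l, hl, rfl⟩, hwl, p, hp, h1, h2⟩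
  · exfalso
    have h3 : dist (l⁻¹ w) q ≤ ρ (r + 1) := mem_image_iff_inv.1 hwl
    have h4 := hE r l⁻¹ (J.inv_mem hl) (h3.trans (hρ2 r)) p (thick_mono _ (not_lt.1 hrs) hp)
      (mem_image_iff_inv.1 h1) (mem_image_iff_inv.1 h2)
    linarith

end

section
variable {X : Type*} [MetricSpace X] [CompactSpace X]

/-- The annuli `(j m)⁻¹ A` along a sparse subsequence of a conical sequence form a chain. -/
theorem exists_conical_chain {J : Subgroup (X ≃ₜ X)} {w q b c : X} (hwq : w ≠ q)
    (hq : q ∈ limitSet J) {j : ℕ → X ≃ₜ X} (hj : IsConvSeq j c q)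
    (hjq : Tendsto (fun k => j k q) atTop (𝓝 b)) {A A' : Set X} (hA : A ∈ 𝓝 c) (hA' : A' ∈ 𝓝 b)
    (hd : Disjoint A A') :
    ∃ m : ℕ → ℕ, (∀ k, j (m k) q ∈ interior A' ∧ j (m k) w ∈ A) ∧
      ∀ k l, k < l → (⇑(j (m k))⁻¹ '' A' ∪ ⇑(j (m l))⁻¹ '' A = univ) ∧
        ⇑(j (m k))⁻¹ '' A ≠ ⇑(j (m l))⁻¹ '' A := by
  have hev : ∀ᶠ k in atTop, j k q ∈ interior A' ∧ j k w ∈ A :=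
    (hjq.eventually_mem (isOpen_interior.mem_nhds (mem_interior_iff_mem_nhds.2 hA'))).and
      ((hj.tendsto hwq).eventually_mem hA)
  refine exists_seq_of_forall_finset_exists (fun m => j m q ∈ interior A' ∧ j m w ∈ A)
    (fun k l => (⇑(j k)⁻¹ '' A' ∪ ⇑(j l)⁻¹ '' A = univ) ∧ ⇑(j k)⁻¹ '' A ≠ ⇑(j l)⁻¹ '' A)
    fun s hs => ?_
  refine (hev.and ((Filter.eventually_all_finset s).2 fun m hm => ?_)).exists
  have hq' : q ∉ (j m ⁻¹' interior A')ᶜ := fun h => h (hs m hm).1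
  have hopen : IsOpen (j m ⁻¹' interior A') := isOpen_interior.preimage (j m).continuous
  obtain ⟨z, hz, hzq⟩ := exists_ne_of_mem_nhds_limitSet hq (hopen.mem_nhds (hs m hm).1)
  filter_upwards [hj _ hopen.isClosed_compl.isCompact hq' A hA,
    (hj.tendsto hzq).eventually_mem hA] with l hl hlz
  constructor
  · rw [eq_univ_iff_forall]
    intro y
    by_cases hy : j m y ∈ interior A'
    · exact Or.inl ⟨_, interior_subset hy, inv_app_self _ _⟩
    · exact Or.inr ⟨_, hl y hy, inv_app_self _ _⟩
  · intro heq
    have h1 : z ∈ ⇑(j m)⁻¹ '' A := heq ▸ ⟨_, hlz, inv_app_self _ _⟩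
    obtain ⟨y, hy, hyz⟩ := h1
    rw [← hyz, mem_preimage, app_inv_self] at hz
    exact disjoint_left.1 hd hy (interior_subset hz)

open Classical in
theorem exists_heightFunction {J : Subgroup (X ≃ₜ X)} (hJ : IsDiscreteConvGroup J) {w : X}
    (hw : w ∉ limitSet J) {Q : Set X} (hQc : Q.Countable) (hQ : Q ⊆ limitSet J) :
    ∃ f : Set X → ℝ, (∀ p, 0 ≤ f p) ∧
      (∀ q ∈ limitSet J, Conic J q → ∃ j ∈ J, ∃ U ∈ 𝓝 q, ∀ p : Set X,
        (∃ y ∈ p, y ∉ closure (limitSet J)) → p ⊆ U → f (j '' p) + 2 ≤ f p) ∧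
      (∀ q ∈ Q, ∀ V ∈ 𝓝 q, ∃ N ∈ 𝓝 q, ∀ h ∈ J, h w ∈ N → ∀ p : Set X,
        (∃ y ∈ p, y ∉ closure (limitSet J)) → Disjoint (h '' p) V → f (h '' p) + 2 ≤ f p) := by
  rcases (limitSet J).eq_empty_or_nonempty with hemp | hΛ
  · refine ⟨fun _ => 0, fun _ => le_rfl, fun q hq => ?_, fun q hq => ?_⟩
    · rw [hemp] at hq; exact hq.elim
    · have := hQ hq
      rw [hemp] at this; exact this.elim
  obtain ⟨D, hD, hDex⟩ := exists_annuli X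
  have hT : ∀ q : Q, _ := fun q => exists_tower hJ hw (hQ q.2)
  choose ρ hρ0 hρ2 hρE hρt using hT
  let fam : ℕ ⊕ Q → Set (Set X × Set X) := fun i => Sum.elim
    (fun n => {Y | ∃ l ∈ J, Y = (l '' (D n).1, l '' (D n).2)}) (fun q : Q => towerFamily J q (ρ q)) i
  have : Countable Q := hQc
  obtain ⟨e, he⟩ := exists_surjective_nat (ℕ ⊕ Q)
  have hρlt : ∀ (q : Q) r, Metric.closedBall (q : X) (ρ q (r + 1)) ⊆ Metric.ball q (ρ q r) :=
    fun q r => Metric.closedBall_subset_ball (by linarith [hρ0 q r, hρ2 q r])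
  have hρanti : ∀ q, Antitone (ρ q) := fun q =>
    antitone_nat_of_succ_le fun r => by linarith [hρ0 q r, hρ2 q r]
  obtain ⟨f, θ, C, hθ, hf0, hf⟩ := exists_height J w hΛ (fun i => fam (e i)) (by
      intro l hl i
      rcases e i with n | q
      · rintro _ ⟨l', hl', rfl⟩
        exact ⟨l * l', J.mul_mem hl hl', by simp only [mul_image]⟩
      · rintro _ ⟨r, l', hl', rfl⟩
        exact ⟨r, l * l', J.mul_mem hl hl', by simp only [mul_image]⟩) (by
      intro i
      rcases e i with n | q
      · rintro _ ⟨l', hl', rfl⟩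
        exact (disjoint_image_iff l'.injective).2 (hD n).2.2
      · rintro _ ⟨r, l', hl', rfl⟩
        exact (disjoint_image_iff l'.injective).2 (disjoint_compl_right_iff_subset.2 (hρlt q r)))
      (by
      intro i s
      rcases e i with n | q
      · exact finite_lost_orbit hJ hw (hD n).1 (hD n).2.1 (hD n).2.2 s
      · exact finite_lost_tower hJ hw (hρ0 q) (hρ2 q) (hρE q) s)
  refine ⟨f, hf0, fun q hq hcon => ?_, fun q hq V hV => ?_⟩
  · obtain ⟨j, hjJ, b, c, hbc, hj, hjq⟩ := hcon
    have hwq : w ≠ q := fun h => hw (h ▸ hq)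
    obtain ⟨n, hn1, hn2⟩ := hDex b c hbc
    obtain ⟨i, hi⟩ := he (Sum.inl n)
    have hd := dist_pos.2 hbc
    obtain ⟨s, hs⟩ := mem_thick_of_dist (Λ := limitSet J) (show 0 < dist b c / 3 by linarith)
    obtain ⟨g, hg⟩ := exists_nat_gt ((C s + 2) / θ i)
    rw [div_lt_iff₀ (hθ i)] at hg
    obtain ⟨m, hm, hmm⟩ := exists_conical_chain hwq hq hj hjq hn1 hn2 (hD n).2.2
    let Y : ℕ → Set X × Set X := fun k => (⇑(j (m k))⁻¹ '' (D n).1, ⇑(j (m k))⁻¹ '' (D n).2)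
    let O : ℕ → Set X := fun k => j (m k) ⁻¹' interior (D n).2
    have hO : ∀ k, IsOpen (O k) := fun k => isOpen_interior.preimage (j (m k)).continuous
    have hOY : ∀ k, O k ⊆ (Y k).2 := fun k y hy => ⟨_, interior_subset hy, inv_app_self _ _⟩
    choose z hz hzq using fun k => exists_ne_of_mem_nhds_limitSet hq ((hO k).mem_nhds (hm k).1)
    let K : Set X := {w} ∪ ⋃ k ∈ Finset.range g, ((O k)ᶜ ∪ {z k})
    have hK : IsCompact K := isCompact_singleton.union
      ((Finset.range g).isCompact_biUnion fun k _ =>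
        (hO k).isClosed_compl.isCompact.union isCompact_singleton)
    have hqK : q ∉ K := by
      rintro (h | h)
      · exact hwq h.symm
      · simp only [mem_iUnion] at h
        obtain ⟨k, -, h | h⟩ := h
        · exact h (hm k).1
        · exact hzq k (mem_singleton_iff.1 h).symm
    have hε : 0 < dist b c / 3 := by linarith
    obtain ⟨k₀, hk1, hk2⟩ := ((hj K hK hqK _ (Metric.ball_mem_nhds c hε)).and
      (hjq.eventually_mem (Metric.ball_mem_nhds b hε))).exists
    refine ⟨j k₀, hjJ k₀, (j k₀ ⁻¹' Metric.ball b (dist b c / 3)) ∩ ⋂ k ∈ Finset.range g, O k,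
      inter_mem ((j k₀).continuous.continuousAt (Metric.isOpen_ball.mem_nhds hk2))
        ((Filter.biInter_finset_mem _).2 fun k _ => (hO k).mem_nhds (hm k).1), fun p hp hpU => ?_⟩
    have hinj : Function.Injective Y := by
      refine injective_of_lt_ne fun k l hkl h => (hmm k l hkl).2 (congrArg Prod.fst h)
    have hsum : ∑ e ∈ (Finset.range g).image fun k => (i, Y k), θ e.1 = g * θ i := by
      rw [Finset.sum_image fun _ _ _ _ h => hinj (Prod.ext_iff.1 h).2]
      simp
    have := hf s p (j k₀) K ((Finset.range g).image fun k => (i, Y k)) (hjJ _) ⟨?_, ?_⟩ hp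
      (Or.inl rfl) ?_ ?_
    · rw [hsum] at this
      linarith
    · intro e' he'
      obtain ⟨k, hk, rfl⟩ := Finset.mem_image.1 he'
      refine ⟨?_, ⟨_, (hm k).2, inv_app_self _ _⟩, fun y hy => hOY k ?_⟩
      · show Y k ∈ fam (e i)
        rw [hi]
        exact ⟨(j (m k))⁻¹, J.inv_mem (hjJ _), rfl⟩
      · exact mem_iInter₂.1 (hpU hy).2 k hk
    · intro e₁ he₁ e₂ he₂ hne
      obtain ⟨k, hk, rfl⟩ := Finset.mem_image.1 he₁
      obtain ⟨l, hl, rfl⟩ := Finset.mem_image.1 he₂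
      rcases lt_trichotomy k l with h | rfl | h
      · exact Or.inl (hmm k l h).1
      · exact (hne rfl).elim
      · exact Or.inr (hmm l k h).1
    · intro e' he'
      obtain ⟨k, hk, rfl⟩ := Finset.mem_image.1 he'
      refine ⟨fun y hy => Or.inr (mem_biUnion hk (Or.inl fun h => hy (hOY k h))), z k,
        Or.inr (mem_biUnion hk (Or.inr rfl)), hOY k (hz k)⟩
    · intro y hy y' hy'
      refine hs _ _ ?_
      have h1 : dist (j k₀ y) c < dist b c / 3 := hk1 y hy
      have h2 : dist (j k₀ y') b < dist b c / 3 := (hpU hy').1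
      have h3 := dist_triangle4 b (j k₀ y') (j k₀ y) c
      rw [dist_comm b (j k₀ y'), dist_comm (j k₀ y') (j k₀ y)] at h3
      linarith
  · obtain ⟨q, rfl⟩ : ∃ q' : Q, (q' : X) = q := ⟨⟨q, hq⟩, rfl⟩
    obtain ⟨i, hi⟩ := he (Sum.inr q)
    obtain ⟨δ, hδ, hδV⟩ := Metric.mem_nhds_iff.1 hV
    obtain ⟨s, hs⟩ := mem_thick_of_dist (Λ := limitSet J) (half_pos hδ)
    obtain ⟨g, hg⟩ := exists_nat_gt ((C s + 2) / θ i)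
    rw [div_lt_iff₀ (hθ i)] at hg
    have hρpow : ∀ r, ρ q r ≤ ρ q 0 * (1 / 2) ^ r := by
      intro r
      induction r with
      | zero => simp
      | succ r ih =>
        have := hρ2 q r
        rw [pow_succ]
        linarith
    obtain ⟨r₀, hr₀⟩ : ∃ r, ρ q r < δ / 2 := by
      have hlim : Tendsto (fun r : ℕ => ρ q 0 * (1 / 2 : ℝ) ^ r) atTop (𝓝 (ρ q 0 * 0)) :=
        (tendsto_pow_atTop_nhds_zero_of_lt_one (by norm_num) (by norm_num)).const_mul _
      rw [mul_zero] at hlim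
      obtain ⟨r, hr⟩ := (hlim.eventually_lt_const (half_pos hδ)).exists
      exact ⟨r, (hρpow r).trans_lt hr⟩
    refine ⟨Metric.closedBall q (ρ q (r₀ + g + 1)),
      Metric.closedBall_mem_nhds _ (hρ0 q _), fun h hh hhw p hp hpV => ?_⟩
    let Y : ℕ → Set X × Set X := fun r => (⇑(h⁻¹) '' Metric.closedBall q (ρ q (r + 1)),
      ⇑(h⁻¹) '' (Metric.ball (q : X) (ρ q r))ᶜ)
    have hYne : ∀ r r', r < r' → Y r ≠ Y r' := by
      intro r r' hrr heq
      obtain ⟨t, ht1, ht2⟩ := hρt q (r + 1)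
      have h1 : h⁻¹ t ∈ (Y r).1 := mem_image_of_mem _ (Metric.ball_subset_closedBall ht1)
      rw [heq] at h1
      obtain ⟨t', ht', htt⟩ := h1
      rw [(h⁻¹).injective htt] at ht'
      have h2 : dist t q ≤ ρ q (r' + 1) := ht'
      have := hρanti q (show r + 1 + 1 ≤ r' + 1 by omega)
      linarith
    have hinj : Function.Injective Y := injective_of_lt_ne hYne
    have hYu : ∀ r r', r < r' → (Y r').2 ∪ (Y r).1 = univ := by
      intro r r' hrr
      show ⇑(h⁻¹) '' _ ∪ ⇑(h⁻¹) '' _ = univ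
      rw [← image_union, ← image_univ_of_surjective (h⁻¹).surjective]
      congr 1
      rw [eq_univ_iff_forall]
      intro y
      by_cases hy : y ∈ Metric.ball (q : X) (ρ q r')
      · refine Or.inr ?_
        have h1 : dist y q < ρ q r' := hy
        have h2 := hρanti q (show r + 1 ≤ r' by omega)
        exact (h1.le.trans h2 : dist y q ≤ ρ q (r + 1))
      · exact Or.inl hy
    have hsum : ∑ e ∈ (Finset.Ioc r₀ (r₀ + g)).image fun k => (i, Y k), θ e.1 = g * θ i := by
      rw [Finset.sum_image fun _ _ _ _ h => hinj (Prod.ext_iff.1 h).2]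
      simp
    have hball : Metric.ball (q : X) δ ⊆ V := hδV
    have hrV : ∀ r, r₀ ≤ r → Metric.ball (q : X) (ρ q r) ⊆ V := fun r hr =>
      (Metric.ball_subset_ball (by linarith [hρanti q hr])).trans hball
    have := hf s p h (⇑(h⁻¹) '' Metric.closedBall q (ρ q r₀))
      ((Finset.Ioc r₀ (r₀ + g)).image fun k => (i, Y k)) hh ⟨?_, ?_⟩ hp ?_ ?_ ?_
    · rw [hsum] at this
      linarith
    · intro e' he'
      obtain ⟨r, hr, rfl⟩ := Finset.mem_image.1 he'
      rw [Finset.mem_Ioc] at hr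
      refine ⟨?_, ⟨h w, ?_, inv_app_self _ _⟩, fun y hy => ⟨h y, ?_, inv_app_self _ _⟩⟩
      · show Y r ∈ fam (e i)
        rw [hi]
        exact ⟨r, h⁻¹, J.inv_mem hh, rfl⟩
      · exact Metric.closedBall_subset_closedBall (hρanti q (by omega)) hhw
      · exact fun hc => disjoint_left.1 hpV (mem_image_of_mem _ hy) (hrV r hr.1.le hc)
    · intro e₁ he₁ e₂ he₂ hne
      obtain ⟨k, hk, rfl⟩ := Finset.mem_image.1 he₁
      obtain ⟨l, hl, rfl⟩ := Finset.mem_image.1 he₂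
      rcases lt_trichotomy k l with h | rfl | h
      · exact Or.inr (hYu k l h)
      · exact (hne rfl).elim
      · exact Or.inl (hYu l k h)
    · exact ⟨h w, Metric.closedBall_subset_closedBall (hρanti q (by omega)) hhw, inv_app_self _ _⟩
    · intro e' he'
      obtain ⟨r, hr, rfl⟩ := Finset.mem_image.1 he'
      rw [Finset.mem_Ioc] at hr
      have hrr := hρanti q hr.1.le
      have hrr' := hρanti q (show r₀ + 1 ≤ r by omega)
      constructor
      · show (⇑(h⁻¹) '' (Metric.ball (q : X) (ρ q r))ᶜ)ᶜ ⊆ _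
        rw [← image_compl_eq (h⁻¹).bijective, compl_compl]
        exact image_mono ((Metric.ball_subset_ball hrr).trans Metric.ball_subset_closedBall)
      · obtain ⟨t, ht1, ht2⟩ := hρt q r₀
        refine ⟨h⁻¹ t, mem_image_of_mem _ (Metric.ball_subset_closedBall ht1),
          mem_image_of_mem _ fun hc => ?_⟩
        have : dist t q < ρ q r := hc
        linarith
    · rintro _ ⟨y, hy, rfl⟩ y' hy'
      rw [app_inv_self]
      refine hs _ _ ?_
      have h1 : dist y q ≤ ρ q r₀ := hy
      have h2 : ¬ dist (h y') q < δ := fun hc =>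
        disjoint_left.1 hpV (mem_image_of_mem _ hy') (hball hc)
      have h3 := dist_triangle_left (h y') q y
      linarith

end

section
variable {X : Type*} [MetricSpace X] [CompactSpace X]

theorem IsParabolicElem.pow_ne_one {g : X ≃ₜ X} (hg : IsParabolicElem g) {n : ℕ} (hn : 0 < n) :
    g ^ n ≠ 1 := by
  intro h
  refine hg.1 ?_
  have hfin : (Set.range fun n : ℤ => toCM (g ^ n)).Finite := by
    have h1 : ((Subgroup.zpowers g : Subgroup (X ≃ₜ X)) : Set (X ≃ₜ X)).Finite :=
      finite_zpowers.2 (isOfFinOrder_iff_pow_eq_one.2 ⟨n, hn, h⟩)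
    refine (h1.image toCM).subset ?_
    rintro _ ⟨n, rfl⟩
    exact ⟨g ^ n, ⟨n, rfl⟩, rfl⟩
  refine ⟨?_, ?_⟩ <;> rw [hfin.isClosed.closure_eq]
  · exact hfin.isCompact
  · rintro _ ⟨n, rfl⟩
    exact ⟨_, rfl⟩

theorem conj_conv_false {H : Subgroup (X ≃ₜ X)} [Infinite X] (hH : IsDiscreteConvGroup H)
    {g : X ≃ₜ X} {q b c : X} (hgH : g ∈ H) (hord : ∀ n, 0 < n → g ^ n ≠ 1)
    (hfix : ∀ x, g x = x → x = q) {f : ℕ → X ≃ₜ X} (hfH : ∀ n, f n ∈ H)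
    (hf : IsConvSeq f c q) (hfq : Tendsto (fun n => f n q) atTop (𝓝 b)) (hbc : b ≠ c)
    (hconj : IsConvSeq (fun n => f n * g * (f n)⁻¹) c b) : False := by
  obtain ⟨U, V, hU, hV, hbU, hcV, hUV⟩ := t2_separation hbc
  obtain ⟨z₁, hz₁, -⟩ := exists_ne₂ q q
  obtain ⟨z₂, hz₂, h21⟩ := exists_ne₂ q z₁
  obtain ⟨z₃, hz₃, h31, h32⟩ := exists_ne₃ q z₁ z₂
  have hVe : ∀ z, z ≠ q → ∀ᶠ n in atTop, f n z ∈ V := fun z hz =>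
    (hf.tendsto hz).eventually_mem (hV.mem_nhds hcV)
  obtain ⟨n, h1, h2, h3, h4, h5⟩ := ((hconj Uᶜ hU.isClosed_compl.isCompact (fun h => h hbU) V
    (hV.mem_nhds hcV)).and ((hfq.eventually_mem (hU.mem_nhds hbU)).and
      ((hVe z₁ hz₁).and ((hVe z₂ hz₂).and (hVe z₃ hz₃))))).exists
  set ψ := f n * g * (f n)⁻¹ with hψ
  have hψH : ψ ∈ H := H.mul_mem (H.mul_mem (hfH n) hgH) (H.inv_mem (hfH n))
  have hψfix : ∀ x, ψ x = x → x = f n q := by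
    intro x hx
    have : g ((f n)⁻¹ x) = (f n)⁻¹ x := by
      have h := congrArg (⇑(f n)⁻¹) hx
      rwa [hψ, mul_app, mul_app, inv_app_self] at h
    rw [← hfix _ this, app_inv_self]
  have hVU : V ⊆ Uᶜ := fun x hx hxU => disjoint_left.1 hUV hxU hx
  have hinj : Function.Injective fun k : ℕ => ψ ^ k := by
    rw [injective_pow_iff_not_isOfFinOrder]
    intro hfin
    obtain ⟨m, hm, h⟩ := isOfFinOrder_iff_pow_eq_one.1 hfin
    refine hord m hm ?_
    rw [hψ, conj_pow] at h
    exact conj_eq_one_iff.1 h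
  obtain ⟨φ, hφ, a, r, har⟩ := hH _ (fun k => H.pow_mem hψH k) hinj
  obtain ⟨y, hyV, hyr, hyr'⟩ : ∃ y ∈ V, y ≠ r ∧ ψ y ≠ r := by
    have hi : ∀ {x y}, x ≠ y → f n x ≠ f n y := fun h h' => h ((f n).injective h')
    have hi' : ∀ {x y}, ψ x = r → ψ y = r → x = y := fun h h' => ψ.injective (h.trans h'.symm)
    by_contra! hcon
    have e1 := hcon _ h3
    have e2 := hcon _ h4
    have e3 := hcon _ h5
    have n1 := hi h21
    have n2 := hi h31
    have n3 := hi h32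
    by_cases c1 : f n z₁ = r
    · have c2 : f n z₂ ≠ r := fun h => n1 (h.trans c1.symm)
      have c3 : f n z₃ ≠ r := fun h => n2 (h.trans c1.symm)
      exact n3 (hi' (e3 c3) (e2 c2))
    · by_cases c2 : f n z₂ = r
      · have c3 : f n z₃ ≠ r := fun h => n3 (h.trans c2.symm)
        exact n2 (hi' (e3 c3) (e1 c1))
      · exact n1 (hi' (e2 c2) (e1 c1))
  have hmem : ∀ k : ℕ, (ψ ^ k) y ∈ Uᶜ := by
    intro k
    induction k with
    | zero => exact hVU hyV
    | succ k ih =>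
      rw [pow_succ', mul_app]
      exact hVU (h1 _ ih)
  have hla := har.tendsto hyr
  have haU : a ∈ Uᶜ := hU.isClosed_compl.mem_of_tendsto hla (Eventually.of_forall fun k => hmem _)
  have hla' : Tendsto (fun k => ψ ((ψ ^ φ k) y)) atTop (𝓝 a) := by
    refine (har.tendsto hyr').congr fun k => ?_
    show (ψ ^ φ k) (ψ y) = _
    rw [← mul_app, ← mul_app, ← pow_succ, ← pow_succ']
  have hfa := tendsto_nhds_unique ((ψ.continuous.tendsto a).comp hla) hla'
  exact haU (hψfix a hfa ▸ h2)

/-- A parabolic fixed point of a discrete convergence group is not conical. -/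
theorem not_conic_of_isParabolicPt {H : Subgroup (X ≃ₜ X)} [Infinite X]
    (hH : IsDiscreteConvGroup H) {q : X} (hq : IsParabolicPt H q) : ¬ Conic H q := by
  rintro ⟨f, hfH, b, c, hbc, hf, hfq⟩
  obtain ⟨g, hgH, hg, hgq⟩ := hq
  have hfix : ∀ x, g x = x → x = q := fun x hx => hg.2.unique hx hgq
  obtain ⟨z, hz, -⟩ := exists_ne₂ q q
  have hgz : g z ≠ q := fun h => hz (g.injective (h.trans hgq.symm))
  obtain ⟨φ, hφ, ⟨ψ, hψ⟩ | ⟨-, s, t, hst⟩⟩ := hH.dichotomy (g := fun n => f n * g * (f n)⁻¹)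
    (fun n => H.mul_mem (H.mul_mem (hfH n) hgH) (H.inv_mem (hfH n)))
  · have hψfix : ∀ k x, ψ x = x → x = f (φ k) q := by
      intro k x hx
      rw [← hψ k, mul_app, mul_app] at hx
      have h := congrArg (⇑(f (φ k))⁻¹) hx
      rw [inv_app_self] at h
      rw [← hfix _ h, app_inv_self]
    have hψq : ∀ k, ψ (f (φ k) q) = f (φ k) q := by
      intro k
      rw [← hψ k, mul_app, mul_app, inv_app_self, hgq]
    have hlim : ∀ {x l}, Tendsto (fun n => f n x) atTop (𝓝 l) →
        Tendsto (fun n => f n (g x)) atTop (𝓝 l) → ψ l = l := by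
      intro x l hx hgx
      refine tendsto_nhds_unique ((ψ.continuous.tendsto l).comp (hx.comp hφ.tendsto_atTop))
        ((hgx.comp hφ.tendsto_atTop).congr fun k => ?_)
      show f (φ k) (g x) = ψ (f (φ k) x)
      rw [← hψ k, mul_app, mul_app, inv_app_self]
    have hb := hψfix 0 b (hlim hfq (by rwa [hgq]))
    have hc := hψfix 0 c (hlim (hf.tendsto hz) (hf.tendsto hgz))
    exact hbc (hb.trans hc.symm)
  · have hf' := hf.comp hφ
    have hfq' := hfq.comp hφ.tendsto_atTop
    have hcase : ∀ {x l}, Tendsto (fun n => f (φ n) x) atTop (𝓝 l) →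
        Tendsto (fun n => f (φ n) (g x)) atTop (𝓝 l) → l ≠ t → s = l := by
      intro x l hx hgx hlt
      refine tendsto_nhds_unique (hst.tendsto_of_tendsto hx hlt) (hgx.congr fun k => ?_)
      show f (φ k) (g x) = (f (φ k) * g * (f (φ k))⁻¹) (f (φ k) x)
      rw [mul_app, mul_app, inv_app_self]
    have hsb : b ≠ t → s = b := hcase hfq' (by rw [hgq]; exact hfq')
    have hsc : c ≠ t → s = c := hcase (hf'.tendsto hz) (hf'.tendsto hgz)
    by_cases hbt : b = t
    · obtain rfl := hsc fun h => hbc (hbt.trans h.symm)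
      subst hbt
      exact conj_conv_false hH hgH (fun n hn => hg.pow_ne_one hn) hfix
        (fun n => hfH (φ n)) hf' hfq' hbc hst
    · obtain rfl := hsb hbt
      have hct : c = t := by
        by_contra h
        exact hbc (hsc h)
      subst hct
      refine conj_conv_false hH (H.inv_mem hgH) (fun n hn h => hg.pow_ne_one hn ?_)
        (fun x hx => hfix x ?_) (fun n => hfH (φ n)) hf' hfq' hbc ?_
      · rwa [inv_pow, inv_eq_one] at h
      · have := congrArg g hx
        rw [app_inv_self] at this
        exact this.symm
      · have := hst.inv
        convert this using 2 with n
        simp only [Function.comp, mul_inv_rev, inv_inv, mul_assoc]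

end

section
variable {X : Type*} [MetricSpace X] [CompactSpace X]

/-- Two discrete convergence groups in ping-pong position, indexed by the booleans. -/
structure IsPingPong (Gs : Bool → Subgroup (X ≃ₜ X)) (J : Subgroup (X ≃ₜ X)) (B : Bool → Set X) :
    Prop where
  le : ∀ i, J ≤ Gs i
  disc : ∀ i, IsDiscreteConvGroup (Gs i)
  closed : ∀ i, IsClosed (B i)
  int_nonempty : ∀ i, (interior (B i)).Nonempty
  disj : ∀ i, Disjoint (B i) (interior (B !i))
  inv : ∀ i, ∀ j ∈ J, ∀ x ∈ B i, j x ∈ B i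
  pp : ∀ i, ∀ a ∈ Gs i, a ∉ J → ∀ x ∈ B i, a x ∈ interior (B !i)
  lim : ∀ i, limitSet (Gs i) \ limitSet J ⊆ interior (B !i)
  proper : ∀ i, ∃ a ∈ Gs i, a ∉ J

namespace IsPingPong

variable {Gs : Bool → Subgroup (X ≃ₜ X)} {J : Subgroup (X ≃ₜ X)} {B : Bool → Set X}

theorem discJ (h : IsPingPong Gs J B) : IsDiscreteConvGroup J := (h.disc true).mono (h.le true)

theorem inv_interior (h : IsPingPong Gs J B) {i : Bool} {j : X ≃ₜ X} (hj : j ∈ J) {x : X}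
    (hx : x ∈ interior (B i)) : j x ∈ interior (B i) := by
  have h1 : ⇑(j⁻¹) ⁻¹' interior (B i) ⊆ interior (B i) := by
    refine interior_maximal (fun y hy => ?_) (isOpen_interior.preimage (j⁻¹).continuous)
    have := h.inv i j hj _ (interior_subset hy)
    rwa [app_inv_self] at this
  exact h1 (by rwa [mem_preimage, inv_app_self])

theorem limJ_subset (h : IsPingPong Gs J B) (i : Bool) : limitSet J ⊆ B i := by
  rintro a ⟨g, hg, hi, b, hab⟩
  obtain ⟨y, hy, hyb⟩ := exists_ne_of_isOpen (mem_limitSet_of_repelling hg hi hab)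
    isOpen_interior (h.int_nonempty i)
  exact (h.closed i).mem_of_tendsto (hab.tendsto hyb)
    (Eventually.of_forall fun k => h.inv i _ (hg k) _ (interior_subset hy))

theorem notMem_closure (h : IsPingPong Gs J B) {i : Bool} {x : X} (hx : x ∈ interior (B i)) :
    x ∉ closure (limitSet J) := by
  intro hc
  have h1 : x ∈ B !i := closure_minimal (h.limJ_subset _) (h.closed _) hc
  refine disjoint_left.1 (h.disj !i) h1 ?_
  rwa [Bool.not_not]

theorem notMem_limitSet (h : IsPingPong Gs J B) {i : Bool} {x : X} (hx : x ∈ interior (B i)) :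
    x ∉ limitSet (Gs i) := by
  intro hc
  have h1 : x ∈ B !i := by
    by_cases hJ : x ∈ limitSet J
    · exact h.limJ_subset _ hJ
    · exact interior_subset (h.lim i ⟨hc, hJ⟩)
  refine disjoint_left.1 (h.disj !i) h1 ?_
  rwa [Bool.not_not]

theorem mem_of_fix (h : IsPingPong Gs J B) {i : Bool} {a : X ≃ₜ X} (ha : a ∈ Gs i) {q : X}
    (hq : q ∈ limitSet J) (haq : a q = q) : a ∈ J := by
  by_contra hJ
  have := h.pp i a ha hJ q (h.limJ_subset i hq)
  rw [haq] at this
  exact disjoint_left.1 (h.disj i) (h.limJ_subset i hq) this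

theorem countable (h : IsPingPong Gs J B) : (J : Set (X ≃ₜ X)).Countable := by
  obtain ⟨w, hw⟩ := h.int_nonempty true
  obtain ⟨y, hy⟩ := h.int_nonempty false
  have hwy : w ≠ y := fun h' =>
    disjoint_left.1 (h.disj true) (interior_subset hw) (h' ▸ hy)
  have hwJ : w ∉ limitSet J := fun h' => h.notMem_closure hw (subset_closure h')
  have hyJ : y ∉ limitSet J := fun h' => h.notMem_closure hy (subset_closure h')
  have hfin : ∀ s : ℕ, {l | l ∈ J ∧ 1 / ((s : ℝ) + 1) < dist (l w) (l y)}.Finite := by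
    intro s
    by_contra hinf
    let F := Set.Infinite.natEmbedding _ hinf
    have hF : ∀ k, (F k : X ≃ₜ X) ∈ J := fun k => (F k).2.1
    have hFi : Function.Injective fun k => (F k : X ≃ₜ X) :=
      fun m n h => F.injective (Subtype.ext h)
    obtain ⟨φ, hφ, a, b, hab⟩ := h.discJ _ hF hFi
    have hb := mem_limitSet_of_repelling (g := (fun k => (F k : X ≃ₜ X)) ∘ φ)
      (fun k => hF _) (hFi.comp hφ.injective) hab
    have hwb : w ≠ b := fun h' => hwJ (h' ▸ hb)
    have hyb : y ≠ b := fun h' => hyJ (h' ▸ hb)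
    have h1 := (hab.tendsto hwb).dist (hab.tendsto hyb)
    rw [dist_self] at h1
    have hpos : (0 : ℝ) < 1 / ((s : ℝ) + 1) := by positivity
    obtain ⟨k, hk⟩ := (h1.eventually_lt_const hpos).exists
    exact lt_asymm hk (F (φ k)).2.2
  refine (countable_iUnion fun s => (hfin s).countable).mono fun l hl => ?_
  obtain ⟨s, hs⟩ := exists_nat_one_div_lt (dist_pos.2 fun h' => hwy (l.injective h'))
  exact mem_iUnion.2 ⟨s, hl, hs⟩

theorem countable_parabolic (h : IsPingPong Gs J B) :
    {q | q ∈ limitSet J ∧ IsParabolicPt J q}.Countable := by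
  refine (h.countable.biUnion fun g (_ : g ∈ (J : Set (X ≃ₜ X))) =>
    (show {q | IsParabolicElem g ∧ g q = q}.Countable from
      Set.Subsingleton.countable fun x hx y hy => hx.1.2.unique hx.2 hy.2)).mono ?_
  rintro q ⟨-, g, hg, hgp, hgq⟩
  exact mem_biUnion hg ⟨hgp, hgq⟩

/-- All left `J`-modifications of the sequence `e` subconverge, shrinking `P` to the attracting
point. -/
def Tame (J : Subgroup (X ≃ₜ X)) (e : ℕ → X ≃ₜ X) (P : Set X) : Prop :=
  ∀ ψ : ℕ → ℕ, StrictMono ψ → ∀ j : ℕ → X ≃ₜ X, (∀ n, j n ∈ J) →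
    ∃ φ : ℕ → ℕ, StrictMono φ ∧ ∃ s t, IsConvSeq (fun n => j (φ n) * e (ψ (φ n))) s t ∧
      Shrinks (fun n => ⇑(j (φ n) * e (ψ (φ n))) '' P) s

theorem exists_normalization (h : IsPingPong Gs J B) (hJgf : IsGeomFinite J) {i : Bool}
    (hgf : IsGeomFinite (Gs i)) {e : ℕ → X ≃ₜ X} (he : ∀ n, e n ∈ Gs i) (heJ : ∀ n, e n ∉ J)
    {P : Set X} (hP : P.Nonempty) (hPB : P ⊆ B i) (hS : Tame J e P) :
    ∃ j : ℕ → X ≃ₜ X, (∀ n, j n ∈ J) ∧ ∀ ψ : ℕ → ℕ, StrictMono ψ → ∀ q ∈ limitSet J,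
      ¬ Shrinks (fun n => ⇑(j (ψ n) * e (ψ n)) '' P) q := by
  obtain ⟨w, hw⟩ := h.int_nonempty i
  have hwJ : w ∉ limitSet J := fun hc => h.notMem_closure hw (subset_closure hc)
  obtain ⟨f, hf0, hE1, hE2⟩ := exists_heightFunction h.discJ hwJ h.countable_parabolic
    fun q hq => hq.1
  have hmin : ∀ n, ∃ j ∈ J, ∀ j' ∈ J, f (⇑(j * e n) '' P) ≤ f (⇑(j' * e n) '' P) + 1 := by
    intro n
    let W : Set ℝ := {r | ∃ j ∈ J, r = f (⇑(j * e n) '' P)}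
    have hW : W.Nonempty := ⟨_, 1, J.one_mem, rfl⟩
    have hWb : BddBelow W := ⟨0, by rintro _ ⟨j, -, rfl⟩; exact hf0 _⟩
    obtain ⟨_, ⟨j, hj, rfl⟩, hlt⟩ := exists_lt_of_csInf_lt hW
      (show sInf W < sInf W + 1 by linarith)
    exact ⟨j, hj, fun j' hj' => by linarith [csInf_le hWb ⟨j', hj', rfl⟩]⟩
  choose j hj hjmin using hmin
  refine ⟨j, hj, fun ψ hψ q hq hsh => ?_⟩
  have := infinite_of_mem_limitSet hq
  obtain ⟨x₀, hx₀⟩ := hP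
  have hpt : ∀ n, ∃ y ∈ ⇑(j n * e n) '' P, y ∉ closure (limitSet J) := fun n =>
    ⟨_, mem_image_of_mem _ hx₀, h.notMem_closure
      (h.inv_interior (hj n) (h.pp i _ (he n) (heJ n) _ (hPB hx₀)))⟩
  have hmin' : ∀ n, ∀ l ∈ J, ¬ f (l '' (⇑(j n * e n) '' P)) + 2 ≤ f (⇑(j n * e n) '' P) := by
    intro n l hl hc
    have := hjmin n (l * j n) (J.mul_mem hl (hj n))
    rw [mul_assoc, mul_image l] at this
    linarith
  have hncJ : ¬ Conic J q := by
    intro hcon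
    obtain ⟨l, hl, U, hU, hlU⟩ := hE1 q hq hcon
    obtain ⟨n, hn⟩ := (hsh U hU).exists
    exact hmin' _ l hl (hlU _ (hpt _) hn)
  have hpJ : IsParabolicPt J q :=
    ((hJgf q hq).resolve_left fun hc => hncJ (hc.conic h.discJ)).1
  have hncH : ¬ Conic (Gs i) q := by
    obtain ⟨g, hg, hgp⟩ := hpJ
    exact not_conic_of_isParabolicPt (h.disc i) ⟨g, h.le i hg, hgp⟩
  have hqH := limitSet_mono (h.le i) hq
  obtain ⟨K, hK, hKq, hKh⟩ :=
    ((hgf q hqH).resolve_left fun hc => hncH (hc.conic (h.disc i))).2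
  have huq : ∀ n, (j (ψ n) * e (ψ n)) q ∈ limitSet (Gs i) \ {q} := by
    intro n
    have hm : j (ψ n) * e (ψ n) ∈ Gs i := (Gs i).mul_mem (h.le i (hj _)) (he _)
    refine ⟨app_mem_limitSet hm hqH, fun hc => heJ (ψ n) ?_⟩
    exact (J.mul_mem_cancel_left (hj _)).1 (h.mem_of_fix hm hq hc)
  choose l hlH hlq hlK using fun n => hKh _ (huq n)
  have hlJ : ∀ n, l n ∈ J := fun n => h.mem_of_fix (hlH n) hq (hlq n)
  obtain ⟨φ, hφ, s, t, hst, hsts⟩ := hS ψ hψ (fun n => l n * j (ψ n))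
    fun n => J.mul_mem (hlJ n) (hj _)
  have huK : ∀ n, (l (φ n) * j (ψ (φ n)) * e (ψ (φ n))) q ∈ K := fun n => hlK _
  have hsq : s ≠ q := by
    rintro rfl
    by_cases hqt : s = t
    · subst hqt
      obtain ⟨k, χ, hχ, hk⟩ := exists_subseq_tendsto fun n =>
        (l (φ n) * j (ψ (φ n)) * e (ψ (φ n))) s
      have hkK : k ∈ K := hK.isClosed.mem_of_tendsto hk (Eventually.of_forall fun n => huK _)
      exact hncH ⟨_, fun n => (Gs i).mul_mem (h.le i (J.mul_mem (hlJ _) (hj _))) (he _), k, s,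
        (hKq hkK).2, hst.comp hχ, hk⟩
    · exact (hKq (hK.isClosed.mem_of_tendsto (hst.tendsto hqt)
        (Eventually.of_forall fun n => huK n))).2 rfl
  have hux : Tendsto (fun n => (l (φ n) * j (ψ (φ n)) * e (ψ (φ n))) x₀) atTop (𝓝 s) :=
    hsts.tendsto fun n => mem_image_of_mem _ hx₀
  have hjx : Tendsto (fun n => (j (ψ (φ n)) * e (ψ (φ n))) x₀) atTop (𝓝 q) :=
    (hsh.comp hφ).tendsto fun n => mem_image_of_mem _ hx₀
  obtain ⟨χ, hχ, ⟨m, hm⟩ | ⟨-, c, t', hct⟩⟩ := h.discJ.dichotomy (g := l ∘ φ) fun n => hlJ _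
  · refine hsq ?_
    have h1 : m q = q := by
      rw [← hm 0]
      exact hlq _
    have h2 := (m.continuous.tendsto q).comp (hjx.comp hχ.tendsto_atTop)
    rw [h1] at h2
    refine tendsto_nhds_unique (hux.comp hχ.tendsto_atTop) (h2.congr fun n => ?_)
    rw [← hm n]
    rfl
  · have hqt' : q = t' := by
      by_contra hne
      have h1 := tendsto_nhds_unique (hct.tendsto_of_tendsto (hjx.comp hχ.tendsto_atTop) hne)
        (hux.comp hχ.tendsto_atTop)
      have h2 : Tendsto (fun n => l (φ (χ n)) q) atTop (𝓝 c) := hct.tendsto hne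
      simp only [hlq] at h2
      exact hsq (h1.symm.trans (tendsto_nhds_unique tendsto_const_nhds h2).symm)
    subst hqt'
    have hcq : q = c := by
      by_contra hne
      refine hncJ ⟨_, fun n => hlJ _, q, c, hne, hct, ?_⟩
      simp only [hlq]
      exact tendsto_const_nhds
    subst hcq
    have hwq : w ≠ q := fun hc => hwJ (hc ▸ hq)
    obtain ⟨U, V, hU, hV, hqU, hsV, hUV⟩ := t2_separation hsq.symm
    obtain ⟨N, hN, hNh⟩ := hE2 q ⟨hq, hpJ⟩ U (hU.mem_nhds hqU)
    obtain ⟨n, hn1, hn2⟩ := (((hct.tendsto hwq).eventually_mem hN).and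
      (hsts.comp hχ V (hV.mem_nhds hsV))).exists
    refine hmin' _ (l (φ (χ n))) (hlJ _) (hNh _ (hlJ _) hn1 _ (hpt (ψ (φ (χ n)))) ?_)
    rw [← mul_image, ← mul_assoc]
    exact hUV.symm.mono_left hn2

end IsPingPong

end

section
variable {X : Type*} [MetricSpace X] [CompactSpace X]

theorem exists_compact_exhaustion {U : Set X} (hU : IsOpen U) :
    ∃ C : ℕ → Set X, (∀ n, IsCompact (C n)) ∧ (∀ n, C n ⊆ U) ∧ Monotone C ∧
      ∀ x ∈ U, ∃ n, C n ∈ 𝓝 x := by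
  refine ⟨fun n => {x | ∀ y ∉ U, 1 / ((n : ℝ) + 1) ≤ dist x y}, fun n => ?_, fun n x hx => ?_,
    fun m n hmn x hx y hy => ?_, fun x hx => ?_⟩
  · refine IsClosed.isCompact ?_
    simp only [Set.ofPred_forall]
    exact isClosed_iInter fun y => isClosed_iInter fun _ =>
      isClosed_le continuous_const (continuous_id.dist continuous_const)
  · by_contra hxU
    have := hx x hxU
    rw [dist_self] at this
    exact absurd this (not_le.2 (by positivity))
  · exact (one_div_le_one_div_of_le (by positivity) (by gcongr)).trans (hx y hy)
  · obtain ⟨ε, hε, hεU⟩ := Metric.isOpen_iff.1 hU x hx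
    obtain ⟨n, hn⟩ := exists_nat_one_div_lt (half_pos hε)
    refine ⟨n, mem_of_superset (Metric.ball_mem_nhds x (half_pos hε)) fun z hz y hy => ?_⟩
    by_contra! hlt
    refine hy (hεU ?_)
    rw [Metric.mem_ball] at hz ⊢
    linarith [dist_triangle_left y x z]

theorem IsCompact.subset_exhaustion {K U : Set X} {C : ℕ → Set X} (hK : IsCompact K) (hKU : K ⊆ U)
    (hmono : Monotone C) (hC : ∀ x ∈ U, ∃ n, C n ∈ 𝓝 x) : ∃ n, K ⊆ C n := by
  obtain ⟨n, hn⟩ := hK.elim_directed_cover (fun n => interior (C n)) (fun _ => isOpen_interior)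
    (fun x hx => by
      obtain ⟨n, hn⟩ := hC x (hKU hx)
      exact mem_iUnion.2 ⟨n, mem_interior_iff_mem_nhds.2 hn⟩)
    (Monotone.directed_le fun m n hmn => interior_mono (hmono hmn))
  exact ⟨n, hn.trans interior_subset⟩

namespace IsPingPong

variable {Gs : Bool → Subgroup (X ≃ₜ X)} {J : Subgroup (X ≃ₜ X)} {B : Bool → Set X}

theorem image_eq (h : IsPingPong Gs J B) {i : Bool} {j : X ≃ₜ X} (hj : j ∈ J) :
    j '' B i = B i := by
  refine Subset.antisymm (image_subset_iff.2 fun x hx => h.inv i j hj x hx) fun x hx => ?_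
  exact mem_image_iff_inv.2 (h.inv i _ (J.inv_mem hj) x hx)

theorem image_eq_of_coset (h : IsPingPong Gs J B) {i : Bool} {a b : X ≃ₜ X} (hab : a⁻¹ * b ∈ J) :
    b '' B i = a '' B i := by
  conv_rhs => rw [← h.image_eq (i := i) hab, ← mul_image, mul_inv_cancel_left]

theorem mul_notMem (_h : IsPingPong Gs J B) {j a : X ≃ₜ X} (hj : j ∈ J) (ha : a ∉ J) :
    j * a ∉ J := fun hc => ha ((J.mul_mem_cancel_left hj).1 hc)

theorem injective_mul {e j : ℕ → X ≃ₜ X} (hd : ∀ m n, m < n → e m * (e n)⁻¹ ∉ J)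
    (hj : ∀ n, j n ∈ J) {ψ : ℕ → ℕ} (hψ : StrictMono ψ) :
    Function.Injective fun n => j n * e (ψ n) := by
  refine injective_of_lt_ne fun m n hmn hc => hd _ _ (hψ hmn) ?_
  have h1 : e (ψ m) * (e (ψ n))⁻¹ = (j m)⁻¹ * j n := by
    rw [mul_inv_eq_iff_eq_mul, mul_assoc, ← hc, inv_mul_cancel_left]
  rw [h1]
  exact J.mul_mem (J.inv_mem (hj m)) (hj n)

theorem tame_singleton (h : IsPingPong Gs J B) {i : Bool} {w : X} (hw : w ∈ interior (B i))
    {e : ℕ → X ≃ₜ X} (he : ∀ n, e n ∈ Gs i) (hd : ∀ m n, m < n → e m * (e n)⁻¹ ∉ J) :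
    Tame J e {w} := by
  intro ψ hψ j hj
  have hg : ∀ n, j n * e (ψ n) ∈ Gs i := fun n => (Gs i).mul_mem (h.le i (hj n)) (he _)
  have hi := injective_mul hd hj hψ
  obtain ⟨φ, hφ, s, t, hst⟩ := h.disc i _ hg hi
  have ht := mem_limitSet_of_repelling (fun k => hg (φ k)) (hi.comp hφ.injective) hst
  have hwt : w ≠ t := fun hc => h.notMem_limitSet hw (hc ▸ ht)
  refine ⟨φ, hφ, s, t, hst, ?_⟩
  simp only [image_singleton]
  exact shrinks_singleton (hst.tendsto hwt)

/-- The translates of `B i` by elements of `Gs i` in distinct left cosets of `J` subconverge to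
points of the limit set. -/
theorem exists_shrinks (h : IsPingPong Gs J B) (hJgf : IsGeomFinite J) {i : Bool}
    (hgf : IsGeomFinite (Gs i)) {a : ℕ → X ≃ₜ X} (ha : ∀ n, a n ∈ Gs i) (haJ : ∀ n, a n ∉ J)
    (hd : ∀ m n, m < n → (a m)⁻¹ * a n ∉ J) :
    ∃ φ : ℕ → ℕ, StrictMono φ ∧ ∃ s ∈ limitSet (Gs i), Shrinks (fun n => a (φ n) '' B i) s := by
  obtain ⟨w, hw⟩ := h.int_nonempty i
  have he : ∀ n, (a n)⁻¹ ∈ Gs i := fun n => (Gs i).inv_mem (ha n)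
  have hd' : ∀ m n, m < n → (a m)⁻¹ * ((a n)⁻¹)⁻¹ ∉ J := by simpa only [inv_inv] using hd
  have hT := h.tame_singleton hw he hd'
  obtain ⟨j, hj, hjn⟩ := h.exists_normalization hJgf hgf he
    (fun n hc => haJ n (J.inv_mem_iff.1 hc)) (singleton_nonempty w)
    (singleton_subset_iff.2 (interior_subset hw)) hT
  obtain ⟨φ, hφ, s, t, hst, hs⟩ := hT id strictMono_id j hj
  have hg : ∀ n, j (φ n) * (a (φ n))⁻¹ ∈ Gs i := fun n => (Gs i).mul_mem (h.le i (hj _)) (he _)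
  have hi : Function.Injective fun n => j (φ n) * (a (φ n))⁻¹ :=
    (injective_mul hd' hj strictMono_id).comp hφ.injective
  have hsB : s ∉ B i := fun hc => disjoint_left.1 (h.disj i) hc <| h.lim i
    ⟨mem_limitSet_of_attracting hg hi hst, fun hc' => hjn φ hφ s hc' hs⟩
  refine ⟨φ, hφ, t, mem_limitSet_of_repelling hg hi hst, ?_⟩
  have h1 := hst.inv.shrinks_closed (h.closed i) hsB
  intro U hU
  filter_upwards [h1 U hU] with n hn
  rintro _ ⟨x, hx, rfl⟩
  have := hn (mem_image_of_mem _ (h.inv i _ (hj (φ n)) x hx))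
  rwa [id, mul_inv_rev, inv_inv, mul_app, inv_app_self] at this

/-- Up to left multiplication by `J`, all the translates of `B i` by elements of `Gs i` outside `J`
lie in a fixed compact subset of the interior of `B !i`. -/
theorem exists_compact_core (h : IsPingPong Gs J B) (hJgf : IsGeomFinite J) {i : Bool}
    (hgf : IsGeomFinite (Gs i)) :
    ∃ C, IsCompact C ∧ C ⊆ interior (B !i) ∧
      ∀ a ∈ Gs i, a ∉ J → ∃ j ∈ J, ⇑(j * a) '' B i ⊆ C := by
  obtain ⟨C, hC, hCU, hmono, hCn⟩ := exists_compact_exhaustion (isOpen_interior (s := B !i))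
  by_contra! hcon
  choose a ha haJ haC using fun n => hcon (C n) (hC n) (hCU n)
  obtain ⟨w, hw⟩ := h.int_nonempty i
  have aux : ∀ ψ : ℕ → ℕ, StrictMono ψ → ∀ j : ℕ → X ≃ₜ X, (∀ n, j n ∈ J) →
      ∃ φ : ℕ → ℕ, StrictMono φ ∧ ∃ s t, IsConvSeq (fun n => j (φ n) * a (ψ (φ n))) s t ∧
        Shrinks (fun n => ⇑(j (φ n) * a (ψ (φ n))) '' B i) s ∧ s ∈ limitSet (Gs i) := by
    intro ψ hψ j hj
    have hg : ∀ n, j n * a (ψ n) ∈ Gs i := fun n => (Gs i).mul_mem (h.le i (hj n)) (ha _)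
    have hgJ : ∀ n, j n * a (ψ n) ∉ J := fun n => h.mul_notMem (hj n) (haJ _)
    obtain ⟨φ, hφ, hc | hc⟩ := exists_subseq_eq_or_ne
      (fun g : X ≃ₜ X => (g : (X ≃ₜ X) ⧸ J)) fun n => j n * a (ψ n)
    · exfalso
      obtain ⟨N, hN⟩ := IsCompact.subset_exhaustion (U := interior (B !i)) (K := ⇑(j (φ 0) * a (ψ (φ 0))) '' B i)
        ((h.closed i).isCompact.image (Homeomorph.continuous _))
        (image_subset_iff.2 fun x hx => h.pp i _ (hg (φ 0)) (hgJ (φ 0)) x hx) hmono hCn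
      refine haC (ψ (φ N)) (j (φ N)) (hj _) ?_
      rw [h.image_eq_of_coset (QuotientGroup.eq.1 (hc 0 N))]
      exact hN.trans (hmono ((hφ.le_apply).trans hψ.le_apply))
    · simp only [ne_eq, QuotientGroup.eq] at hc
      obtain ⟨χ, hχ, s, hs, hsh⟩ := h.exists_shrinks hJgf hgf (fun n => hg (φ n))
        (fun n => hgJ (φ n)) hc
      have hi : Function.Injective fun n => j (φ (χ n)) * a (ψ (φ (χ n))) :=
        injective_of_lt_ne fun m n hmn hc' => hc _ _ (hχ hmn) (by
          rw [hc', inv_mul_cancel]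
          exact J.one_mem)
      obtain ⟨θ, hθ, s', t, hst⟩ := h.disc i _ (fun n => hg (φ (χ n))) hi
      have ht := mem_limitSet_of_repelling (fun n => hg (φ (χ (θ n)))) (hi.comp hθ.injective) hst
      have hwt : w ≠ t := fun hc => h.notMem_limitSet hw (hc ▸ ht)
      have hss : s = s' := tendsto_nhds_unique
        ((hsh.comp hθ).tendsto fun n => mem_image_of_mem _ (interior_subset hw)) (hst.tendsto hwt)
      subst hss
      exact ⟨fun n => φ (χ (θ n)), hφ.comp (hχ.comp hθ), s, t, hst, hsh.comp hθ, hs⟩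
  obtain ⟨j, hj, hjn⟩ := h.exists_normalization hJgf hgf ha haJ ⟨w, interior_subset hw⟩
    Subset.rfl fun ψ hψ j hj => by
      obtain ⟨φ, hφ, s, t, h1, h2, -⟩ := aux ψ hψ j hj
      exact ⟨φ, hφ, s, t, h1, h2⟩
  obtain ⟨φ, hφ, s, t, -, h2, h3⟩ := aux id strictMono_id j hj
  obtain ⟨N, hN⟩ := hCn s (h.lim i ⟨h3, fun hc => hjn φ hφ s hc h2⟩)
  obtain ⟨n, hn, hnN⟩ := ((h2 _ hN).and (eventually_ge_atTop N)).exists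
  exact haC (φ n) (j (φ n)) (hj _) (hn.trans (hmono (hnN.trans hφ.le_apply)))

end IsPingPong

end

section
variable {X : Type*} [MetricSpace X] [CompactSpace X]

theorem induction_sup {Gs : Bool → Subgroup (X ≃ₜ X)} {p : (X ≃ₜ X) → Prop} (one : p 1)
    (mul : ∀ i, ∀ a ∈ Gs i, ∀ g, p g → p (a * g)) {g : X ≃ₜ X} (hg : g ∈ Gs true ⊔ Gs false) :
    p g := by
  rw [Subgroup.sup_eq_closure] at hg
  induction hg using Subgroup.closure_induction_left with
  | one => exact one
  | mul_left x hx y _ ih => exact hx.elim (fun h => mul _ _ h _ ih) fun h => mul _ _ h _ ih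
  | inv_mul_cancel x hx y _ ih =>
    exact hx.elim (fun h => mul _ _ ((Gs _).inv_mem h) _ ih) fun h =>
      mul _ _ ((Gs _).inv_mem h) _ ih

/-- Alternating products of elements of `Gs true` and `Gs false` outside `J`, with first letter in
`Gs i`. -/
inductive Alt (Gs : Bool → Subgroup (X ≃ₜ X)) (J : Subgroup (X ≃ₜ X)) : Bool → (X ≃ₜ X) → Prop
  | base {i a} : a ∈ Gs i → a ∉ J → Alt Gs J i a
  | cons {i a h} : a ∈ Gs i → a ∉ J → Alt Gs J (!i) h → Alt Gs J i (a * h)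

namespace IsPingPong

variable {Gs : Bool → Subgroup (X ≃ₜ X)} {J : Subgroup (X ≃ₜ X)} {B : Bool → Set X}

theorem alt_mul_left (h : IsPingPong Gs J B) {j : X ≃ₜ X} (hj : j ∈ J) {i : Bool} {g : X ≃ₜ X}
    (hg : Alt Gs J i g) : Alt Gs J i (j * g) := by
  cases hg with
  | base ha haJ => exact .base ((Gs i).mul_mem (h.le i hj) ha) (h.mul_notMem hj haJ)
  | cons ha haJ hg =>
    rw [← mul_assoc]
    exact .cons ((Gs i).mul_mem (h.le i hj) ha) (h.mul_notMem hj haJ) hg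

theorem mem_or_alt (h : IsPingPong Gs J B) {g : X ≃ₜ X} (hg : g ∈ Gs true ⊔ Gs false) :
    g ∈ J ∨ ∃ i, Alt Gs J i g := by
  refine induction_sup (p := fun g => g ∈ J ∨ ∃ i, Alt Gs J i g) (Or.inl J.one_mem) (fun k a ha g hg => ?_) hg
  by_cases haJ : a ∈ J
  · obtain hg | ⟨i, hg⟩ := hg
    · exact Or.inl (J.mul_mem haJ hg)
    · exact Or.inr ⟨i, h.alt_mul_left haJ hg⟩
  obtain hg | ⟨i, hg⟩ := hg
  · exact Or.inr ⟨k, .base ((Gs k).mul_mem ha (h.le k hg))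
      fun hc => haJ ((J.mul_mem_cancel_right hg).1 hc)⟩
  by_cases hki : i = !k
  · subst hki
    exact Or.inr ⟨k, .cons ha haJ hg⟩
  obtain rfl : i = k := by revert hki; cases i <;> cases k <;> simp
  cases hg with
  | base hb hbJ =>
    by_cases hab : a * g ∈ J
    · exact Or.inl hab
    · exact Or.inr ⟨i, .base ((Gs i).mul_mem ha hb) hab⟩
  | @cons _ b g hb hbJ hg =>
    rw [← mul_assoc]
    by_cases hab : a * b ∈ J
    · exact Or.inr ⟨_, h.alt_mul_left hab hg⟩
    · exact Or.inr ⟨i, .cons ((Gs i).mul_mem ha hb) hab hg⟩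

theorem pp_mem (h : IsPingPong Gs J B) {i : Bool} {a : X ≃ₜ X} (ha : a ∈ Gs i) (haJ : a ∉ J)
    {x : X} (hx : x ∈ B i) : a x ∈ B !i := interior_subset (h.pp i a ha haJ x hx)

theorem pp_mem' (h : IsPingPong Gs J B) {i : Bool} {a : X ≃ₜ X} (ha : a ∈ Gs !i) (haJ : a ∉ J)
    {x : X} (hx : x ∈ B !i) : a x ∈ B i := by
  have := h.pp_mem ha haJ hx
  rwa [Bool.not_not] at this

theorem exists_first_letter (h : IsPingPong Gs J B) {i : Bool} {g : X ≃ₜ X} (hg : Alt Gs J i g) :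
    ∃ a ∈ Gs i, a ∉ J ∧ ∃ c, ∀ x ∈ B c, g x ∈ a '' B i := by
  induction hg with
  | @base i a ha haJ => exact ⟨a, ha, haJ, i, fun x hx => mem_image_of_mem _ hx⟩
  | @cons i a g ha haJ _ ih =>
    obtain ⟨b, hb, hbJ, c, hc⟩ := ih
    refine ⟨a, ha, haJ, c, fun x hx => mem_image_of_mem _ ?_⟩
    obtain ⟨y, hy, hyx⟩ := hc x hx
    change g x ∈ B i
    rw [← hyx]
    exact h.pp_mem' hb hbJ hy

/-- A limit point of `Gs true ⊔ Gs false` which is a limit point of neither group lies in a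
translate of some `B i` by an element of `Gs i` outside `J`. -/
theorem exists_mem_image (h : IsPingPong Gs J B) (hJgf : IsGeomFinite J)
    (hgf : ∀ i, IsGeomFinite (Gs i)) {y : X} (hy : y ∈ limitSet (Gs true ⊔ Gs false))
    (hyG : ∀ i, y ∉ limitSet (Gs i)) : ∃ i, ∃ a ∈ Gs i, a ∉ J ∧ a⁻¹ y ∈ B i := by
  obtain ⟨g, hg, hi, b, hyb⟩ := hy
  have hb := mem_limitSet_of_repelling hg hi hyb
  choose z hz hzb using fun c => exists_ne_of_isOpen hb isOpen_interior (h.int_nonempty c)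
  have hnJ : ∀ᶠ k in atTop, g k ∉ J := by
    by_contra hc
    obtain ⟨φ, hφ, hφJ⟩ := extraction_of_frequently_atTop (P := fun k => g k ∈ J)
      (fun h' => hc h')
    exact hyG true (limitSet_mono (h.le true)
      (mem_limitSet_of_attracting hφJ (hi.comp hφ.injective) (hyb.comp hφ)))
  obtain ⟨N, hN⟩ := eventually_atTop.1 hnJ
  have hex : ∀ k, ∃ i, ∃ a ∈ Gs i, a ∉ J ∧ ∃ c, ∀ x ∈ B c, g (k + N) x ∈ a '' B i := by
    intro k
    obtain ⟨i, hi⟩ := (h.mem_or_alt (hg (k + N))).resolve_left (hN _ (Nat.le_add_left _ _))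
    exact ⟨i, h.exists_first_letter hi⟩
  choose i a ha haJ c hc using hex
  have hlim : Tendsto (fun k => g (k + N) (z (c k))) atTop (𝓝 y) := by
    intro U hU
    have hall : ∀ᶠ k in atTop, ∀ d, g k (z d) ∈ U :=
      eventually_all.2 fun d => (hyb.tendsto (hzb d)).eventually_mem hU
    rw [mem_map]
    filter_upwards [(tendsto_add_atTop_nat N).eventually hall] with k hk
    exact hk _
  have hmem : ∀ k, g (k + N) (z (c k)) ∈ a k '' B (i k) := fun k =>
    hc k _ (interior_subset (hz _))
  obtain ⟨φ, hφ, ⟨i₀, hi₀⟩ | hinj⟩ := exists_subseq_const_or_injective i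
  swap
  · exact absurd hinj (not_injective_infinite_finite _)
  have haφ : ∀ k, a (φ k) ∈ Gs i₀ := fun k => hi₀ k ▸ ha (φ k)
  have hmemφ : ∀ k, g (φ k + N) (z (c (φ k))) ∈ a (φ k) '' B i₀ := fun k => hi₀ k ▸ hmem (φ k)
  obtain ⟨ψ, hψ, hcos | hcos⟩ := exists_subseq_eq_or_ne
      (fun g : X ≃ₜ X => (g : (X ≃ₜ X) ⧸ J)) fun n => a (φ n)
  · refine ⟨i₀, a (φ (ψ 0)), haφ _, haJ _, mem_image_iff_inv.1 ?_⟩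
    refine ((a (φ (ψ 0))).isClosed_image.2 (h.closed i₀)).mem_of_tendsto
      (hlim.comp (hφ.comp hψ).tendsto_atTop) (Eventually.of_forall fun k => ?_)
    rw [← h.image_eq_of_coset (QuotientGroup.eq.1 (hcos 0 k))]
    exact hmemφ _
  · simp only [ne_eq, QuotientGroup.eq] at hcos
    obtain ⟨χ, hχ, s, hs, hsh⟩ := h.exists_shrinks hJgf (hgf i₀) (fun n => haφ (ψ n))
      (fun n => haJ _) hcos
    refine absurd ?_ (hyG i₀)
    rwa [tendsto_nhds_unique (hlim.comp (hφ.comp (hψ.comp hχ)).tendsto_atTop)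
      (hsh.tendsto fun k => hmemφ _)]

/-- The limit points of `Gs true ⊔ Gs false` which are not translates of limit points of the two
factors. -/
def newLimitSet (Gs : Bool → Subgroup (X ≃ₜ X)) : Set X :=
  {y | y ∈ limitSet (Gs true ⊔ Gs false) ∧ ∀ g ∈ Gs true ⊔ Gs false, ∀ i, g y ∉ limitSet (Gs i)}

theorem le_sup (Gs : Bool → Subgroup (X ≃ₜ X)) (i : Bool) : Gs i ≤ Gs true ⊔ Gs false := by
  cases i
  · exact le_sup_right
  · exact le_sup_left

theorem app_mem_newLimitSet {g : X ≃ₜ X} (hg : g ∈ Gs true ⊔ Gs false) {y : X}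
    (hy : y ∈ newLimitSet Gs) : g y ∈ newLimitSet Gs :=
  ⟨app_mem_limitSet hg hy.1, fun g' hg' => hy.2 (g' * g) (mul_mem hg' hg)⟩

theorem exists_mem_of_newLimitSet (h : IsPingPong Gs J B) (hJgf : IsGeomFinite J)
    (hgf : ∀ i, IsGeomFinite (Gs i)) {y : X} (hy : y ∈ newLimitSet Gs) :
    ∃ i, ∃ a ∈ Gs i, a ∉ J ∧ a⁻¹ y ∈ B i :=
  h.exists_mem_image hJgf hgf hy.1 (hy.2 1 (one_mem _))

theorem exists_letter (h : IsPingPong Gs J B) (hJgf : IsGeomFinite J)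
    (hgf : ∀ i, IsGeomFinite (Gs i)) {y : X} (hy : y ∈ newLimitSet Gs) {i : Bool} (hyB : y ∈ B i) :
    ∃ a ∈ Gs !i, a ∉ J ∧ a⁻¹ y ∈ B !i := by
  obtain ⟨k, a, ha, haJ, hay⟩ := h.exists_mem_of_newLimitSet hJgf hgf hy
  by_cases hki : k = !i
  · subst hki
    exact ⟨a, ha, haJ, hay⟩
  obtain rfl : k = i := by revert hki; cases i <;> cases k <;> simp
  have := h.pp k a ha haJ _ hay
  rw [app_inv_self] at this
  exact absurd this (disjoint_left.1 (h.disj k) hyB)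

/-- An infinite alternating word `α 0 * β 0 * α 1 * β 1 * ⋯` with letters in `Gs i` and `Gs !i`,
with partial products `g`. -/
structure Coding (Gs : Bool → Subgroup (X ≃ₜ X)) (J : Subgroup (X ≃ₜ X)) (i : Bool)
    (g α β : ℕ → X ≃ₜ X) : Prop where
  fst_mem : ∀ k, α k ∈ Gs i
  fst_notMem : ∀ k, α k ∉ J
  snd_mem : ∀ k, β k ∈ Gs !i
  snd_notMem : ∀ k, β k ∉ J
  zero : g 0 = α 0
  succ : ∀ k, g (k + 1) = g k * β k * α (k + 1)

theorem exists_coding (h : IsPingPong Gs J B) (hJgf : IsGeomFinite J)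
    (hgf : ∀ i, IsGeomFinite (Gs i)) {x : X} (hx : x ∈ newLimitSet Gs) :
    ∃ i g α β, Coding Gs J i g α β ∧ ∀ k, (g k)⁻¹ x ∈ B i := by
  obtain ⟨i, α₀, hα₀, hα₀J, hα₀x⟩ := h.exists_mem_of_newLimitSet hJgf hgf hx
  have hstep : ∀ y, ∃ β α : X ≃ₜ X, y ∈ newLimitSet Gs → y ∈ B i →
      (β ∈ Gs !i) ∧ β ∉ J ∧ α ∈ Gs i ∧ α ∉ J ∧ (β * α)⁻¹ y ∈ B i := by
    intro y
    by_cases hy : y ∈ newLimitSet Gs ∧ y ∈ B i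
    · obtain ⟨β, hβ, hβJ, hβy⟩ := h.exists_letter hJgf hgf hy.1 hy.2
      obtain ⟨α, hα, hαJ, hαy⟩ := h.exists_letter hJgf hgf
        (app_mem_newLimitSet (inv_mem (le_sup Gs _ hβ)) hy.1) hβy
      rw [Bool.not_not] at hα hαy
      refine ⟨β, α, fun _ _ => ⟨hβ, hβJ, hα, hαJ, ?_⟩⟩
      rwa [mul_inv_rev, mul_app]
    · exact ⟨1, 1, fun h1 h2 => absurd ⟨h1, h2⟩ hy⟩
  choose β α hβα using hstep
  let g : ℕ → X ≃ₜ X := fun k => Nat.rec α₀ (fun _ g => g * β (g⁻¹ x) * α (g⁻¹ x)) k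
  have hg : ∀ k, g k ∈ Gs true ⊔ Gs false ∧ (g k)⁻¹ x ∈ B i := by
    intro k
    induction k with
    | zero => exact ⟨le_sup Gs i hα₀, hα₀x⟩
    | succ k ih =>
      obtain ⟨h1, -, h3, -, h5⟩ := hβα _ (app_mem_newLimitSet (inv_mem ih.1) hx) ih.2
      refine ⟨mul_mem (mul_mem ih.1 (le_sup Gs _ h1)) (le_sup Gs _ h3), ?_⟩
      change (g k * β ((g k)⁻¹ x) * α ((g k)⁻¹ x))⁻¹ x ∈ B i
      rwa [mul_assoc, mul_inv_rev, mul_app]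
  have hstep := fun k => hβα _ (app_mem_newLimitSet (inv_mem (hg k).1) hx) (hg k).2
  refine ⟨i, g, fun k => Nat.casesOn k α₀ fun k => α ((g k)⁻¹ x), fun k => β ((g k)⁻¹ x),
    ⟨?_, ?_, fun k => (hstep k).1, fun k => (hstep k).2.1, rfl, fun k => rfl⟩, fun k => (hg k).2⟩
  · rintro (_ | k)
    · exact hα₀
    · exact (hstep k).2.2.1
  · rintro (_ | k)
    · exact hα₀J
    · exact (hstep k).2.2.2.1

namespace Coding

variable {i : Bool} {g α β : ℕ → X ≃ₜ X}

theorem mem (hc : Coding Gs J i g α β) (k : ℕ) : g k ∈ Gs true ⊔ Gs false := by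
  induction k with
  | zero =>
    rw [hc.zero]
    exact le_sup Gs i (hc.fst_mem 0)
  | succ k ih =>
    rw [hc.succ]
    exact mul_mem (mul_mem ih (le_sup Gs _ (hc.snd_mem k))) (le_sup Gs _ (hc.fst_mem _))

theorem fst_inv_mem (hc : Coding Gs J i g α β) (h : IsPingPong Gs J B) (k : ℕ) {z : X}
    (hz : z ∈ B i) : (α k)⁻¹ z ∈ B !i :=
  h.pp_mem ((Gs i).inv_mem (hc.fst_mem k)) (fun h' => hc.fst_notMem k (J.inv_mem_iff.1 h')) hz

theorem snd_inv_mem (hc : Coding Gs J i g α β) (h : IsPingPong Gs J B) (k : ℕ) {z : X}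
    (hz : z ∈ B !i) : (β k)⁻¹ z ∈ B i :=
  h.pp_mem' ((Gs !i).inv_mem (hc.snd_mem k)) (fun h' => hc.snd_notMem k (J.inv_mem_iff.1 h')) hz

theorem fst_app_succ (hc : Coding Gs J i g α β) (n : ℕ) (z : X) :
    α (n + 1) ((g (n + 1))⁻¹ z) = (β n)⁻¹ ((g n)⁻¹ z) := by
  rw [hc.succ, mul_inv_rev, mul_inv_rev, mul_app, mul_app, app_inv_self]

theorem fst_app_mem (hc : Coding Gs J i g α β) (h : IsPingPong Gs J B) (k : ℕ) {z : X}
    (hz : z ∈ B i) : α k ((g k)⁻¹ z) ∈ B i := by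
  induction k with
  | zero => rwa [hc.zero, app_inv_self]
  | succ k ih =>
    rw [hc.fst_app_succ]
    have := hc.fst_inv_mem h k ih
    rw [inv_app_self] at this
    exact hc.snd_inv_mem h k this

theorem fst_app_mem_of_lt (hc : Coding Gs J i g α β) (h : IsPingPong Gs J B) {m n : ℕ}
    (hmn : m < n) {z : X} (hz : z ∈ B !i) : α n ((g n)⁻¹ (g m z)) ∈ B i := by
  induction n, hmn using Nat.le_induction with
  | base =>
    rw [hc.fst_app_succ, inv_app_self]
    exact hc.snd_inv_mem h m hz
  | succ n hmn ih =>
    rw [hc.fst_app_succ]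
    have := hc.fst_inv_mem h n ih
    rw [inv_app_self] at this
    exact hc.snd_inv_mem h n this

theorem snd_inv_app_mem_of_lt (hc : Coding Gs J i g α β) (h : IsPingPong Gs J B) {m n : ℕ}
    (hmn : m < n) {z : X} (hz : z ∈ B i) : (β m)⁻¹ ((g m)⁻¹ (g n z)) ∈ B !i := by
  induction n, hmn using Nat.le_induction generalizing z with
  | base =>
    rw [hc.succ, mul_app, mul_app, inv_app_self, inv_app_self]
    exact h.pp_mem (hc.fst_mem _) (hc.fst_notMem _) hz
  | succ n hmn ih =>
    rw [hc.succ, mul_app, mul_app]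
    exact ih (h.pp_mem' (hc.snd_mem _) (hc.snd_notMem _)
      (h.pp_mem (hc.fst_mem _) (hc.fst_notMem _) hz))

end Coding

end IsPingPong

end

section
variable {X : Type*} [MetricSpace X] [CompactSpace X]

theorem tendsto_app_inv_app {u v : ℕ → X ≃ₜ X} {f : X ≃ₜ X}
    (hu : TendstoUniformly (fun k => ⇑(u k)) f atTop)
    (hv : TendstoUniformly (fun k => ⇑(v k)) f atTop) (z : X) :
    Tendsto (fun k => u k ((v k)⁻¹ z)) atTop (𝓝 z) := by
  rw [Metric.tendstoUniformly_iff] at hu hv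
  rw [Metric.tendsto_nhds]
  intro ε hε
  filter_upwards [hu (ε / 2) (half_pos hε), hv (ε / 2) (half_pos hε)] with k hk hk'
  have h1 := hk ((v k)⁻¹ z)
  have h2 := hk' ((v k)⁻¹ z)
  rw [app_inv_self] at h2
  linarith [dist_triangle_left (u k ((v k)⁻¹ z)) z (f ((v k)⁻¹ z))]

theorem TendstoHomeo.exists_tendstoUniformly {u : ℕ → X ≃ₜ X} (hu : TendstoHomeo u) :
    ∃ f : X ≃ₜ X, TendstoUniformly (fun k => ⇑(u k)) f atTop := by
  obtain ⟨f, hf⟩ := hu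
  exact ⟨f, ContinuousMap.tendsto_iff_tendstoUniformly.1 hf⟩

namespace IsPingPong

variable {Gs : Bool → Subgroup (X ≃ₜ X)} {J : Subgroup (X ≃ₜ X)} {B : Bool → Set X}

theorem subset_image_of_tendsto (h : IsPingPong Gs J B) {i : Bool} {r a : ℕ → X ≃ₜ X}
    (hr : ∀ z, Tendsto (fun k => r k z) atTop (𝓝 z)) (ha : ∀ k, a k ∈ Gs i)
    (hra : ∀ k, ∀ z ∈ B !i, r k z ∈ a k '' B i) {e : X ≃ₜ X} (he : e ∈ Gs i) (heJ : e ∉ J)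
    {x : X} (hx : x ∈ B !i) : x ∈ e '' B i := by
  obtain ⟨w, hw⟩ := h.int_nonempty i
  have hew : e w ∈ B !i := h.pp_mem he heJ (interior_subset hw)
  have h1 : Tendsto (fun k => e⁻¹ (r k (e w))) atTop (𝓝 w) := by
    have := ((e⁻¹).continuous.tendsto (e w)).comp (hr (e w))
    rwa [inv_app_self] at this
  refine (e.isClosed_image.2 (h.closed i)).mem_of_tendsto (hr x) ?_
  filter_upwards [h1.eventually_mem (isOpen_interior.mem_nhds hw)] with k hk
  have hJ : e⁻¹ * a k ∈ J := by
    by_contra hc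
    obtain ⟨b, hb, hbr⟩ := hra k _ hew
    have h2 := h.pp i _ ((Gs i).mul_mem ((Gs i).inv_mem he) (ha k)) hc b hb
    rw [mul_app, hbr] at h2
    exact disjoint_left.1 (h.disj i) (interior_subset hk) h2
  rw [← h.image_eq_of_coset hJ]
  exact hra k x hx

/-- If the letters swap the two ping-pong sets, then the limit set is empty. -/
theorem limitSet_eq_empty (h : IsPingPong Gs J B)
    (hsw : ∀ i, ∀ e ∈ Gs i, e ∉ J → B (!i) ⊆ e '' B i) : limitSet (Gs true ⊔ Gs false) = ∅ := by
  have hperm : ∀ g ∈ Gs true ⊔ Gs false, ∀ c, ∃ d, ∀ z ∈ B d, g z ∈ B c := by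
    intro g hg
    refine induction_sup (p := fun g => ∀ c, ∃ d, ∀ z ∈ B d, g z ∈ B c)
      (fun c => ⟨c, fun z hz => hz⟩) (fun i a ha g hg c => ?_) hg
    have hac : ∃ d, ∀ z ∈ B d, a z ∈ B c := by
      by_cases haJ : a ∈ J
      · exact ⟨c, h.inv c a haJ⟩
      by_cases hci : c = !i
      · subst hci
        exact ⟨i, fun z hz => h.pp_mem ha haJ hz⟩
      · obtain rfl : c = i := by revert hci; cases i <;> cases c <;> simp
        refine ⟨!c, fun z hz => ?_⟩
        have := hsw c _ ((Gs c).inv_mem ha) (fun h' => haJ (J.inv_mem_iff.1 h')) hz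
        rwa [mem_image_iff_inv, inv_inv] at this
    obtain ⟨d, hd⟩ := hac
    obtain ⟨d', hd'⟩ := hg d
    exact ⟨d', fun z hz => hd _ (hd' z hz)⟩
  have hint : B true ⊆ interior (B true) := by
    obtain ⟨e, he, heJ⟩ := h.proper false
    intro x hx
    obtain ⟨y, hy, rfl⟩ := hsw false e he heJ hx
    exact h.pp false e he heJ y hy
  rw [eq_empty_iff_forall_notMem]
  rintro x ⟨g, hg, hi, b, hxb⟩
  have hb := mem_limitSet_of_repelling hg hi hxb
  choose z hz hzb using fun c => exists_ne_of_isOpen hb isOpen_interior (h.int_nonempty c)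
  have hxB : ∀ c, x ∈ B c := by
    intro c
    choose d hd using fun k => hperm (g k) (hg k) c
    refine (h.closed c).mem_of_tendsto (f := fun k => g k (z (d k))) (b := atTop) ?_
      (Eventually.of_forall fun k => hd k _ (interior_subset (hz _)))
    intro U hU
    have hall : ∀ᶠ k in atTop, ∀ d, g k (z d) ∈ U :=
      eventually_all.2 fun d => (hxb.tendsto (hzb d)).eventually_mem hU
    rw [mem_map]
    filter_upwards [hall] with k hk
    exact hk _
  exact disjoint_left.1 (h.disj false) (hxB false) (hint (hxB true))

theorem isConicalLimitPt_of_isConvSeq {G : Subgroup (X ≃ₜ X)} {f : ℕ → X ≃ₜ X}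
    (hf : ∀ k, f k ∈ G) (hfi : Function.Injective f) {c t : X} (hct : IsConvSeq f c t)
    {A C U : Set X} (hA : IsClosed A) (hAi : (interior A).Nonempty) (hC : IsClosed C)
    (hU : IsOpen U) (hCU : C ⊆ U) (hAU : Disjoint A U) (hAC : ∀ k, f k '' A ⊆ C)
    {x : X} (hx : ∀ k, f k x ∈ A) : IsConicalLimitPt G x := by
  obtain ⟨v, hv, hvt⟩ :=
    exists_ne_of_isOpen (mem_limitSet_of_repelling hf hfi hct) isOpen_interior hAi
  have hcU : c ∈ U := hCU <| hC.mem_of_tendsto (hct.tendsto hvt) <|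
    Eventually.of_forall fun k => hAC k (mem_image_of_mem _ (interior_subset hv))
  have hxt : x = t := by
    by_contra hxt
    exact disjoint_left.1 hAU
      (hA.mem_of_tendsto (hct.tendsto hxt) (Eventually.of_forall hx)) hcU
  subst hxt
  refine ⟨f, hf, hfi, fun z hz => ?_⟩
  obtain ⟨V, hV, hVc, hVU⟩ := exists_mem_nhds_isClosed_subset (hU.mem_nhds hcU)
  obtain ⟨N, hN⟩ := eventually_atTop.1 ((hct.tendsto hz).eventually_mem hV)
  refine ⟨A ×ˢ V ∪ (fun k => (f k x, f k z)) '' Iio N,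
    (hA.isCompact.prod hVc.isCompact).union ((finite_Iio N).image _).isCompact, ?_, fun k => ?_⟩
  · rintro p (⟨h1, h2⟩ | ⟨k, -, rfl⟩) heq
    · exact disjoint_left.1 hAU h1 (hVU (heq ▸ h2))
    · exact hz ((f k).injective heq).symm
  · rcases lt_or_ge k N with hk | hk
    · exact Or.inr ⟨k, hk, rfl⟩
    · exact Or.inl ⟨hx k, hN k hk⟩

/-- In a ping-pong amalgam of geometrically finite groups, the limit points which are not
translates of limit points of the factors are conical. -/
theorem isConicalLimitPt (h : IsPingPong Gs J B) (hJgf : IsGeomFinite J)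
    (hgf : ∀ i, IsGeomFinite (Gs i)) (hG : IsConvGroup (Gs true ⊔ Gs false)) {x : X}
    (hx : x ∈ newLimitSet Gs) : IsConicalLimitPt (Gs true ⊔ Gs false) x := by
  obtain ⟨i, g, α, β, hc, hgx⟩ := h.exists_coding hJgf hgf hx
  obtain ⟨C, hC, hCB, hCa⟩ := h.exists_compact_core hJgf (hgf i)
  have hα : ∀ k, (α k)⁻¹ ∈ Gs i := fun k => (Gs i).inv_mem (hc.fst_mem k)
  choose j hj hjC using fun k => hCa _ (hα k) fun h' => hc.fst_notMem k (J.inv_mem_iff.1 h')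
  let f : ℕ → X ≃ₜ X := fun k => j k * (g k)⁻¹
  have hf : ∀ k, f k ∈ Gs true ⊔ Gs false := fun k =>
    mul_mem (le_sup Gs i (h.le i (hj k))) (inv_mem (hc.mem k))
  have hfx : ∀ k, f k x ∈ B i := fun k => h.inv i _ (hj k) _ (hgx k)
  have hfC : ∀ k, f k '' B i ⊆ C := by
    rintro k _ ⟨z, hz, rfl⟩
    have := hjC k (mem_image_of_mem _ (hc.fst_app_mem h k hz))
    rwa [mul_app, inv_app_self] at this
  obtain ⟨φ, hφ, hlim | ⟨hfi, c, t, hct⟩⟩ := hG.dichotomy hf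
  swap
  · exact isConicalLimitPt_of_isConvSeq (fun k => hf (φ k)) hfi hct (h.closed i)
      (h.int_nonempty i) hC.isClosed isOpen_interior hCB (h.disj i) (fun k => hfC _) fun k => hfx _
  exfalso
  obtain ⟨F, hF⟩ := hlim.exists_tendstoUniformly
  have hF' : TendstoUniformly (fun k => ⇑(f (φ (k + 1)))) F atTop := fun V hV =>
    (tendsto_add_atTop_nat 1).eventually (hF V hV)
  have hlt : ∀ k, φ k < φ (k + 1) := fun k => hφ k.lt_succ_self
  have hfi : ∀ e ∈ Gs i, e ∉ J → B (!i) ⊆ e '' B i := fun e he heJ z hz => by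
    refine h.subset_image_of_tendsto (r := fun k => f (φ (k + 1)) * (f (φ k))⁻¹)
      (tendsto_app_inv_app hF' hF) (a := fun k => j (φ (k + 1)) * (α (φ (k + 1)))⁻¹)
      (fun k => (Gs i).mul_mem (h.le i (hj _)) (hα _)) (fun k z hz => ?_) he heJ hz
    have hz' : (j (φ k))⁻¹ z ∈ B !i := h.inv _ _ (J.inv_mem (hj _)) z hz
    refine ⟨_, hc.fst_app_mem_of_lt h (hlt k) hz', ?_⟩
    simp only [f, mul_inv_rev, inv_inv, mul_app, inv_app_self]
  have hfi' : ∀ e ∈ Gs !i, e ∉ J → B i ⊆ e '' B !i := fun e he heJ z hz => by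
    have hz : z ∈ B !!i := by rwa [Bool.not_not]
    refine h.subset_image_of_tendsto (r := fun k => f (φ k) * (f (φ (k + 1)))⁻¹)
      (tendsto_app_inv_app hF hF') (a := fun k => j (φ k) * β (φ k))
      (fun k => (Gs !i).mul_mem (h.le _ (hj _)) (hc.snd_mem _)) (fun k z hz => ?_) he heJ hz
    rw [Bool.not_not] at hz
    have hz' : (j (φ (k + 1)))⁻¹ z ∈ B i := h.inv _ _ (J.inv_mem (hj _)) z hz
    refine ⟨_, hc.snd_inv_app_mem_of_lt h (hlt k) hz', ?_⟩
    simp only [f, mul_inv_rev, inv_inv, mul_app, app_inv_self]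
  have hempty := h.limitSet_eq_empty fun k e he heJ => by
    by_cases hki : k = i
    · subst hki
      exact hfi e he heJ
    · obtain rfl : k = !i := by revert hki; cases i <;> cases k <;> simp
      rw [Bool.not_not]
      exact hfi' e he heJ
  exact (hempty ▸ hx.1 : x ∈ (∅ : Set X))

end IsPingPong

theorem IsClosed.interior_closure_interior {B : Set X} (hB : IsClosed B) :
    interior (closure (interior B)) = interior B :=
  Subset.antisymm (interior_mono hB.closure_interior_subset)
    (interior_maximal subset_closure isOpen_interior)

theorem image_closure_interior_of_image_eq {j : X ≃ₜ X} {B : Set X} (hj : j '' B = B) :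
    j '' closure (interior B) = closure (interior B) := by
  rw [j.image_closure, j.image_interior, hj]

theorem AFPPingPong.isPingPong {G₁ G₂ J : Subgroup (X ≃ₜ X)} {B₁ B₂ : Set X}
    (h : AFPPingPong G₁ G₂ J B₁ B₂) (hd₁ : IsDiscreteConvGroup G₁) (hd₂ : IsDiscreteConvGroup G₂)
    (hJ₁ : J < G₁) (hJ₂ : J < G₂) :
    IsPingPong (fun i => cond i G₁ G₂) J
      fun i => cond i (closure (interior B₁)) (closure (interior B₂)) := by
  have hint₁ := IsClosed.interior_closure_interior h.isClosed₁
  have hint₂ := IsClosed.interior_closure_interior h.isClosed₂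
  have hsub₁ : closure (interior B₁) ⊆ B₁ := h.isClosed₁.closure_interior_subset
  have hsub₂ : closure (interior B₂) ⊆ B₂ := h.isClosed₂.closure_interior_subset
  have hd : Disjoint (interior B₁) (interior B₂) := disjoint_iff_inter_eq_empty.2 h.int_disjoint
  constructor <;> rintro (_ | _) <;>
    simp only [cond_true, cond_false, Bool.not_true, Bool.not_false, hint₁, hint₂]
  · exact hJ₂.le
  · exact hJ₁.le
  · exact hd₂
  · exact hd₁
  · exact isClosed_closure
  · exact isClosed_closure
  · exact h.int_nonempty₂
  · exact h.int_nonempty₁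
  · exact hd.symm.closure_left isOpen_interior
  · exact hd.closure_left isOpen_interior
  · exact fun j hj x hx =>
      image_closure_interior_of_image_eq (h.inv₂ j hj) ▸ mem_image_of_mem j hx
  · exact fun j hj x hx =>
      image_closure_interior_of_image_eq (h.inv₁ j hj) ▸ mem_image_of_mem j hx
  · exact fun a ha haJ x hx => h.pp₂ a ha haJ (mem_image_of_mem a (hsub₂ hx))
  · exact fun a ha haJ x hx => h.pp₁ a ha haJ (mem_image_of_mem a (hsub₁ hx))
  · exact h.lim₂
  · exact h.lim₁
  · exact SetLike.exists_of_lt hJ₂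
  · exact SetLike.exists_of_lt hJ₁

end

/-- If `G₁` and `G₂` are geometrically finite, then every point of
`Λ(G) ∖ ⋃_{g ∈ G} g (Λ(G₁) ∪ Λ(G₂))` is a conical limit point for `G`. -/
theorem statement_16 {M : Type*} [TopologicalSpace M] [CompactSpace M]
    [TopologicalSpace.MetrizableSpace M]
    (G₁ G₂ J G : Subgroup (M ≃ₜ M))
    (hd₁ : IsDiscreteConvGroup G₁) (hd₂ : IsDiscreteConvGroup G₂)
    (hJ : J = G₁ ⊓ G₂) (hJgf : IsGeomFinite J) (hJlt₁ : J < G₁) (hJlt₂ : J < G₂)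
    (hpp : ∃ B₁ B₂ : Set M, AFPPingPong G₁ G₂ J B₁ B₂)
    (hG : G = G₁ ⊔ G₂) (hGconv : IsConvGroup G)
    (hgf₁ : IsGeomFinite G₁) (hgf₂ : IsGeomFinite G₂) :
    ∀ x ∈ limitSet G \ ⋃ g ∈ G, ⇑g '' (limitSet G₁ ∪ limitSet G₂),
      IsConicalLimitPt G x := by
  let _ := TopologicalSpace.metrizableSpaceMetric M
  obtain ⟨B₁, B₂, hB⟩ := hpp
  rintro x ⟨hx, hxG⟩
  subst hG
  refine (hB.isPingPong hd₁ hd₂ hJlt₁ hJlt₂).isConicalLimitPt hJgf (Bool.rec hgf₂ hgf₁) hGconv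
    ⟨hx, fun g hg i hgx => hxG ?_⟩
  refine mem_iUnion₂.2 ⟨g⁻¹, inv_mem hg, g x, ?_, inv_app_self g x⟩
  cases i
  · exact Or.inr hgx
  · exact Or.inl hgx

end ConvergenceGroups
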